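/- arXiv:2312.05564 — 2 statements merged into one kernel-verified Lean document; each statement's English description precedes it below -/
import Mathlib

section
/- Let G be a finite connected simple graph with minimum degree at least 2 and maximum degree Δ. Then the majority distinguishing index of G satisfies M'_D(G) ≤ ⌈√Δ⌉ + 5; that is, G has an edge coloring with ⌈√Δ⌉ + 5 colors that is both a majority edge coloring and a distinguishing edge coloring. -/
open SimpleGraph

/-- An edge coloring `c` of `G` is a majority edge coloring if for every vertex `u` and
every color `α`, at most half of the edges incident with `u` have color `α`. -/
def IsMajorityEdgeColoring {V : Type*} [Fintype V] [DecidableEq V]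
    (G : SimpleGraph V) [DecidableRel G.Adj] {k : ℕ} (c : Sym2 V → Fin k) : Prop :=
  ∀ u : V, ∀ α : Fin k,
    2 * ((G.neighborFinset u).filter (fun v => c s(u, v) = α)).card ≤ G.degree u

/-- An edge coloring `c` of `G` is distinguishing if the only automorphism of `G`
preserving `c` is the identity. -/
def IsDistinguishingEdgeColoring {V : Type*} (G : SimpleGraph V) {k : ℕ}
    (c : Sym2 V → Fin k) : Prop :=
  ∀ φ : G ≃g G, (∀ u v : V, G.Adj u v → c s(φ u, φ v) = c s(u, v)) → ∀ x : V, φ x = x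

set_option linter.unusedSectionVars false

namespace MDI

theorem greedy {E C L : Type*} [Fintype E] [DecidableEq E] [Nonempty C] [LinearOrder L]
    (rank : E → L) (hinj : Function.Injective rank) (P : E → (E → C) → Prop)
    (hdep : ∀ e c c', (∀ e', rank e' ≤ rank e → c e' = c' e') → P e c → P e c')
    (hext : ∀ e c, (∀ e', rank e' < rank e → P e' c) → ∃ α, P e (Function.update c e α)) :
    ∃ c, ∀ e, P e c := by
  have key : ∀ n : ℕ, ∀ S : Finset E, S.card = n →
      (∀ e ∈ S, ∀ e', rank e' ≤ rank e → e' ∈ S) → ∃ c, ∀ e ∈ S, P e c := by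
    intro n
    induction n with
    | zero =>
      intro S hS _
      rw [Finset.card_eq_zero] at hS
      subst hS
      exact ⟨fun _ => Classical.arbitrary C, by simp⟩
    | succ n ih =>
      intro S hS hlow
      have hne : S.Nonempty := by
        rw [← Finset.card_pos]; omega
      obtain ⟨m, hm, hmax⟩ := S.exists_max_image rank hne
      obtain ⟨c, hc⟩ := ih (S.erase m) (by rw [Finset.card_erase_of_mem hm, hS]; rfl) (by
        intro e he e' hle
        have he2 := Finset.mem_erase.1 he
        refine Finset.mem_erase.2 ⟨?_, hlow e he2.2 e' hle⟩
        rintro rfl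
        exact he2.1 (hinj (le_antisymm (hmax e he2.2) hle)))
      obtain ⟨α, hα⟩ := hext m c (by
        intro e' he'
        apply hc
        refine Finset.mem_erase.2 ⟨?_, hlow m hm e' he'.le⟩
        rintro rfl
        exact lt_irrefl _ he')
      refine ⟨Function.update c m α, ?_⟩
      intro e he
      by_cases hem : e = m
      · subst hem; exact hα
      · refine hdep e c _ ?_ (hc e (Finset.mem_erase.2 ⟨hem, he⟩))
        intro e' he'
        rw [Function.update_of_ne]
        rintro rfl
        exact hem (hinj (le_antisymm (hmax e he) he'))
  obtain ⟨c, hc⟩ := key _ Finset.univ rfl (by simp)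
  exact ⟨c, fun e => hc e (Finset.mem_univ e)⟩

theorem card_le_of_rel {A B : Type*} [DecidableEq A] [DecidableEq B] (S : Finset A) (R : Finset B)
    (rel : A → B → Prop) (h : ∀ a ∈ S, ∃ x ∈ R, rel a x)
    (hinj : ∀ a a' x, rel a x → rel a' x → a = a') : S.card ≤ R.card := by
  classical
  rcases S.eq_empty_or_nonempty with rfl | ⟨a0, ha0⟩
  · simp
  have : Nonempty B := ⟨(h a0 ha0).choose⟩
  choose! f hf using h
  refine Finset.card_le_card_of_injOn f (fun a ha => (hf a ha).1) ?_
  intro a ha a' ha' hff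
  have h2 := (hf a' ha').2
  rw [← hff] at h2
  exact hinj _ _ _ (hf a ha).2 h2

/-- horizontal subgraph -/
def Hor {V : Type*} (G : SimpleGraph V) (lev : V → ℕ) : SimpleGraph V where
  Adj x y := G.Adj x y ∧ lev x = lev y
  symm := ⟨fun _ _ h => ⟨h.1.symm, h.2.symm⟩⟩
  loopless := ⟨fun x h => G.loopless.irrefl x h.1⟩

open Classical in
noncomputable def upS {V : Type*} [Fintype V] (G : SimpleGraph V) (lev : V → ℕ) (x : V) : Finset V :=
  Finset.univ.filter (fun u => G.Adj u x ∧ lev u < lev x)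

open Classical in
noncomputable def dnS {V : Type*} [Fintype V] (G : SimpleGraph V) (lev : V → ℕ) (x : V) : Finset V :=
  Finset.univ.filter (fun y => G.Adj x y ∧ lev x < lev y)

structure Dat {V : Type*} [Fintype V] (G : SimpleGraph V) where
  lev : V → ℕ
  idx : V → ℕ
  p : V → V
  s : V → V
  b : V → V
  fin : V → V
  snk : V → V
  d : V → ℕ
  r : V
  t1 : V
  t2 : V
  lev_adj : ∀ x y, G.Adj x y → lev y ≤ lev x + 1
  idx_inj : Function.Injective idx
  p_mem : ∀ x, (upS G lev x).Nonempty → p x ∈ upS G lev x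
  p_min : ∀ x, ∀ u ∈ upS G lev x, idx (p x) ≤ idx u
  p_congr : ∀ x y, upS G lev x = upS G lev y → p x = p y
  s_mem : ∀ x, 2 ≤ (upS G lev x).card → s x ∈ upS G lev x
  s_ne : ∀ x, 2 ≤ (upS G lev x).card → s x ≠ p x
  s_min : ∀ x, ∀ u ∈ upS G lev x, u ≠ p x → idx (s x) ≤ idx u
  s_congr : ∀ x y, upS G lev x = upS G lev y → s x = s y
  b_b : ∀ x, b (b x) = b x
  b_up : ∀ x, 2 ≤ (upS G lev x).card → upS G lev (b x) = upS G lev x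
  b_congr : ∀ x y, 2 ≤ (upS G lev x).card → upS G lev x = upS G lev y → b x = b y
  b_low : ∀ x, (upS G lev x).card ≤ 1 → (upS G lev (snk x)).card ≤ 1 → b x = snk x
  fin_mem : ∀ u, (dnS G lev u).Nonempty → fin u ∈ dnS G lev u
  fin_spec : ∀ u, (dnS G lev u).Nonempty → (p (fin u) = u ∧ b (fin u) ≠ fin u) ∨
    (b (fin u) = fin u ∧ ∀ y ∈ dnS G lev u, p y = u → b y = y)
  snk_reach : ∀ x, (Hor G lev).Reachable x (snk x)
  snk_congr : ∀ x y, (Hor G lev).Reachable x y → snk x = snk y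
  snk_A : ∀ x y, (Hor G lev).Reachable x y → 2 ≤ (upS G lev y).card →
    2 ≤ (upS G lev (snk x)).card
  d_near : ∀ x, x ≠ snk x → ∃ y, (Hor G lev).Adj x y ∧ d y < d x
  d_snk : ∀ x, d (snk x) = 0
  lev_r : lev r = 0
  lev_zero : ∀ x, lev x = 0 → x = r
  up_ne : ∀ x, lev x ≠ 0 → (upS G lev x).Nonempty
  t_ne : t1 ≠ t2
  adj1 : G.Adj r t1
  adj2 : G.Adj r t2
  bt1 : b t1 ≠ t2
  bt2 : b t2 ≠ t1

namespace Dat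
variable {V : Type*} [Fintype V] {G : SimpleGraph V} (D : Dat G)

noncomputable abbrev up (x : V) := upS G D.lev x
noncomputable abbrev dn (x : V) := dnS G D.lev x

theorem mem_up {x u : V} : u ∈ D.up x ↔ G.Adj u x ∧ D.lev u < D.lev x := by
  simp [up, upS]
theorem mem_dn {x u : V} : u ∈ D.dn x ↔ G.Adj x u ∧ D.lev x < D.lev u := by
  simp [dn, dnS]
theorem mem_dn_up {x u : V} : u ∈ D.dn x ↔ x ∈ D.up u := by
  rw [mem_up, mem_dn]

open Classical in
noncomputable def hor (x : V) : Finset V :=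
  Finset.univ.filter (fun y => G.Adj x y ∧ D.lev x = D.lev y)

theorem mem_hor {x u : V} : u ∈ D.hor x ↔ G.Adj x u ∧ D.lev x = D.lev u := by
  simp [hor]

theorem lev_dn {x y : V} (h : y ∈ D.dn x) : D.lev y = D.lev x + 1 := by
  rw [mem_dn] at h
  have := D.lev_adj x y h.1
  omega

open Classical in
noncomputable def stage (u y : V) : ℤ := if y = D.fin u then 2 else if D.b y = y then 0 else 1

def prim : Sym2 V → ℕ := Sym2.lift ⟨fun x y => D.lev x + D.lev y, fun _ _ => add_comm _ _⟩

def scnd : Sym2 V → ℕ := Sym2.lift ⟨fun x y =>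
  if D.lev x < D.lev y then D.idx x else if D.lev y < D.lev x then D.idx y else
    D.idx (D.snk x) + D.idx (D.snk y), fun x y => by
      dsimp only
      split_ifs <;> omega⟩

noncomputable def ter : Sym2 V → ℤ := Sym2.lift ⟨fun x y =>
  if D.lev x < D.lev y then D.stage x y else if D.lev y < D.lev x then D.stage y x else
    -((D.d x : ℤ) + D.d y), fun x y => by
      dsimp only
      split_ifs <;> omega⟩

noncomputable def rank (e : Sym2 V) : ℕ ×ₗ ℕ ×ₗ ℤ ×ₗ ℕ :=
  toLex (D.prim e, toLex (D.scnd e, toLex (D.ter e,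
    ((Fintype.equivFin (Sym2 V) e : Fin _) : ℕ))))

theorem rank_inj : Function.Injective D.rank := by
  intro e e' h
  have h1 : ((Fintype.equivFin (Sym2 V) e : Fin _) : ℕ) = (Fintype.equivFin (Sym2 V) e' : Fin _) :=
    congrArg (fun z => (ofLex (ofLex (ofLex z).2).2).2) h
  exact (Fintype.equivFin (Sym2 V)).injective (Fin.ext h1)

theorem rank_prim {e e' : Sym2 V} (h : D.prim e < D.prim e') : D.rank e < D.rank e' := by
  rw [rank, rank, Prod.Lex.lt_iff]; exact Or.inl h

theorem rank_scnd {e e' : Sym2 V} (h : D.prim e = D.prim e') (h2 : D.scnd e < D.scnd e') :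
    D.rank e < D.rank e' := by
  rw [rank, rank, Prod.Lex.lt_iff]; refine Or.inr ⟨h, ?_⟩
  dsimp
  rw [Prod.Lex.lt_iff]; exact Or.inl h2

theorem rank_ter {e e' : Sym2 V} (h : D.prim e = D.prim e') (h2 : D.scnd e = D.scnd e')
    (h3 : D.ter e < D.ter e') :
    D.rank e < D.rank e' := by
  rw [rank, rank, Prod.Lex.lt_iff]; refine Or.inr ⟨h, ?_⟩
  dsimp
  rw [Prod.Lex.lt_iff]; refine Or.inr ⟨h2, ?_⟩
  dsimp
  rw [Prod.Lex.lt_iff]; exact Or.inl h3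

theorem prim_mk (x y : V) : D.prim s(x, y) = D.lev x + D.lev y := rfl
theorem scnd_mk (x y : V) : D.scnd s(x, y) = if D.lev x < D.lev y then D.idx x else
  if D.lev y < D.lev x then D.idx y else D.idx (D.snk x) + D.idx (D.snk y) := rfl
theorem ter_mk (x y : V) : D.ter s(x, y) = if D.lev x < D.lev y then D.stage x y else
  if D.lev y < D.lev x then D.stage y x else -((D.d x : ℤ) + D.d y) := rfl

theorem scnd_dn {x y : V} (h : y ∈ D.dn x) : D.scnd s(x, y) = D.idx x := by
  rw [scnd_mk, if_pos (D.mem_dn.1 h).2]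
theorem ter_dn {x y : V} (h : y ∈ D.dn x) : D.ter s(x, y) = D.stage x y := by
  rw [ter_mk, if_pos (D.mem_dn.1 h).2]
theorem prim_dn {x y : V} (h : y ∈ D.dn x) : D.prim s(x, y) = 2 * D.lev x + 1 := by
  rw [prim_mk, D.lev_dn h]; ring

theorem snk_hor {x y : V} (h : y ∈ D.hor x) : D.snk y = D.snk x := by
  rw [mem_hor] at h
  exact (D.snk_congr x y (SimpleGraph.Adj.reachable (G := Hor G D.lev) h)).symm

theorem scnd_hor {x y : V} (h : y ∈ D.hor x) : D.scnd s(x, y) = 2 * D.idx (D.snk x) := by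
  have h2 := (D.mem_hor.1 h).2
  rw [scnd_mk, if_neg (by omega), if_neg (by omega), D.snk_hor h]; ring
theorem ter_hor {x y : V} (h : y ∈ D.hor x) : D.ter s(x, y) = -((D.d x : ℤ) + D.d y) := by
  have h2 := (D.mem_hor.1 h).2
  rw [ter_mk, if_neg (by omega), if_neg (by omega)]
theorem prim_hor {x y : V} (h : y ∈ D.hor x) : D.prim s(x, y) = 2 * D.lev x := by
  rw [prim_mk, ← (D.mem_hor.1 h).2]; ring

/-- all down edges: by index of the upper vertex -/
theorem rank_dn_dn {u u' y y' : V} (h : y ∈ D.dn u) (h' : y' ∈ D.dn u') (hl : D.lev u = D.lev u')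
    (hi : D.idx u < D.idx u') : D.rank s(u, y) < D.rank s(u', y') := by
  apply D.rank_scnd
  · rw [D.prim_dn h, D.prim_dn h', hl]
  · rw [D.scnd_dn h, D.scnd_dn h']; exact hi

theorem rank_fin {u y : V} (h : y ∈ D.dn u) (hne : y ≠ D.fin u) :
    D.rank s(u, y) < D.rank s(u, D.fin u) := by
  have hf := D.fin_mem u ⟨y, h⟩
  apply D.rank_ter
  · rw [D.prim_dn h, D.prim_dn hf]
  · rw [D.scnd_dn h, D.scnd_dn hf]
  · rw [D.ter_dn h, D.ter_dn hf]; unfold stage; split_ifs <;> simp_all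

theorem rank_b {u y : V} (h : y ∈ D.dn u) (hp : D.p y = u) (hb : D.b y ≠ y)
    (h2 : D.b y ∈ D.dn u) : D.rank s(u, D.b y) < D.rank s(u, y) := by
  apply D.rank_ter
  · rw [D.prim_dn h, D.prim_dn h2]
  · rw [D.scnd_dn h, D.scnd_dn h2]
  · rw [D.ter_dn h, D.ter_dn h2]
    have hbb := D.b_b y
    have hnf : D.b y ≠ D.fin u := by
      intro hf
      rcases D.fin_spec u ⟨y, h⟩ with h3 | h3
      · rw [← hf] at h3; exact h3.2 hbb
      · exact hb (h3.2 y h hp)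
    unfold stage
    rw [if_neg hnf, if_pos hbb]
    split_ifs <;> simp_all

theorem rank_dn_hor {u y z : V} (h : y ∈ D.dn u) (h2 : z ∈ D.hor y) :
    D.rank s(u, y) < D.rank s(y, z) := by
  apply D.rank_prim
  rw [D.prim_dn h, D.prim_hor h2, D.lev_dn h]; omega

end Dat
end MDI

namespace MDI
namespace Dat
variable {V : Type*} [Fintype V] [DecidableEq V] {G : SimpleGraph V} [DecidableRel G.Adj]
  (D : Dat G) {k : ℕ}

def key (u y : V) : Prop := y ∈ D.dn u ∧ D.p y = u

def rival (c : Sym2 V → Fin (k + 5)) (x x' : V) : Prop :=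
  x' ≠ x ∧ D.key (D.p x) x ∧ D.key (D.p x) x' ∧ c s(D.p x, x') = c s(D.p x, x)

noncomputable def dsum (c : Sym2 V → Fin (k + 5)) (x : V) : ℕ := ∑ y ∈ D.dn x, (c s(x, y)).val
noncomputable def hsum (c : Sym2 V → Fin (k + 5)) (x : V) : ℕ := ∑ y ∈ D.hor x, (c s(x, y)).val

def sp (e : Sym2 V) : Prop := e = s(D.r, D.t1) ∨ e = s(D.r, D.t2)

noncomputable def majc (c : Sym2 V → Fin (k + 5)) (x y : V) : ℕ :=
  ((G.neighborFinset x).filter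
    (fun z => c s(x, z) = c s(x, y) ∧ D.rank s(x, z) < D.rank s(x, y))).card

noncomputable def capc (c : Sym2 V → Fin (k + 5)) (x y : V) : ℕ :=
  ((D.dn x).filter
    (fun z => D.p z = x ∧ c s(x, z) = c s(x, y) ∧ D.rank s(x, z) < D.rank s(x, y))).card

def Pmaj (c : Sym2 V → Fin (k + 5)) (x y : V) : Prop := 2 * (D.majc c x y + 1) ≤ G.degree x
def Pcap (c : Sym2 V → Fin (k + 5)) (x y : V) : Prop :=
  D.key x y → y ≠ D.fin x → D.capc c x y + 1 ≤ k - 1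
def Pbne (c : Sym2 V → Fin (k + 5)) (x y : V) : Prop :=
  D.key x y → D.b y ≠ y → D.key x (D.b y) → c s(x, y) ≠ c s(x, D.b y)
def Psec (c : Sym2 V → Fin (k + 5)) (x y : V) : Prop :=
  x = D.s y → 2 ≤ (D.up y).card → ∀ y', D.rival c y y' → D.up y' = D.up y →
    D.rank s(x, y') < D.rank s(x, y) → c s(x, y) ≠ c s(x, y')
def Pdsm (c : Sym2 V → Fin (k + 5)) (x y : V) : Prop :=
  y ∈ D.dn x → y = D.fin x → ∀ x', D.rival c x x' → D.idx x' < D.idx x → D.dsum c x' ≠ D.dsum c x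
def Phsm (c : Sym2 V → Fin (k + 5)) (x y : V) : Prop :=
  y ∈ D.hor x → x ≠ D.snk x → (∀ z ∈ D.hor x, D.rank s(x, z) ≤ D.rank s(x, y)) →
    ∀ x', D.rival c x x' → (∀ z ∈ D.hor x', D.rank s(x', z) < D.rank s(x, y)) →
    D.hsum c x' ≠ D.hsum c x

structure Q (c : Sym2 V → Fin (k + 5)) (x y : V) : Prop where
  nz : c s(x, y) ≠ 0
  maj : D.Pmaj c x y
  cap : D.Pcap c x y
  bne : D.Pbne c x y
  sec : D.Psec c x y
  dsm : D.Pdsm c x y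
  hsm : D.Phsm c x y

def P (e : Sym2 V) (c : Sym2 V → Fin (k + 5)) : Prop :=
  ∀ x y, e = s(x, y) → G.Adj x y → (D.sp e → c e = 0) ∧ (¬ D.sp e → D.Q c x y)

theorem p_key {x : V} (h : (D.up x).Nonempty) : D.key (D.p x) x :=
  ⟨D.mem_dn_up.2 (D.p_mem x h), rfl⟩

theorem adj_cases {x z : V} (h : G.Adj x z) : z ∈ D.up x ∨ z ∈ D.hor x ∨ z ∈ D.dn x := by
  rw [D.mem_up, D.mem_hor, D.mem_dn]
  rcases lt_trichotomy (D.lev x) (D.lev z) with h1 | h1 | h1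
  · exact Or.inr (Or.inr ⟨h, h1⟩)
  · exact Or.inr (Or.inl ⟨h, h1⟩)
  · exact Or.inl ⟨h.symm, h1⟩

theorem rank_key_hd {u y x z : V} (h : y ∈ D.dn u) (hl : D.lev y = D.lev x)
    (hz : z ∈ D.hor x ∨ z ∈ D.dn x) : D.rank s(u, y) < D.rank s(x, z) := by
  apply D.rank_prim
  rw [D.prim_dn h]
  have := D.lev_dn h
  rcases hz with hz | hz
  · rw [D.prim_hor hz]; omega
  · rw [D.prim_dn hz]; omega

theorem rank_p {x z : V} (hx : G.Adj x z) (hu : (D.up x).Nonempty) (hz : z ≠ D.p x) :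
    D.rank s(D.p x, x) < D.rank s(x, z) := by
  rcases D.adj_cases hx with h | h
  · rw [Sym2.eq_swap (a := x)]
    have h1 := D.p_key hu
    have h2 := D.mem_dn_up.2 h
    refine D.rank_dn_dn h1.1 h2 ?_ (lt_of_le_of_ne (D.p_min x z h) ?_)
    · have := D.lev_dn h1.1; have := D.lev_dn h2; omega
    · intro h3; exact hz (D.idx_inj h3).symm
  · exact D.rank_key_hd (D.p_key hu).1 rfl h

theorem rank_s {x z : V} (hx : G.Adj x z) (hu : 2 ≤ (D.up x).card) (hz : z ≠ D.p x)
    (hz2 : z ≠ D.s x) :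
    D.rank s(D.s x, x) < D.rank s(x, z) := by
  have h1 := D.mem_dn_up.2 (D.s_mem x hu)
  rcases D.adj_cases hx with h | h
  · rw [Sym2.eq_swap (a := x)]
    have h2 := D.mem_dn_up.2 h
    refine D.rank_dn_dn h1 h2 ?_ (lt_of_le_of_ne (D.s_min x z h hz) ?_)
    · have := D.lev_dn h1; have := D.lev_dn h2; omega
    · intro h3; exact hz2 (D.idx_inj h3).symm
  · exact D.rank_key_hd h1 rfl h

theorem rank_p_s {y y' : V} (hu : 2 ≤ (D.up y).card) (h : D.key (D.p y) y') :
    D.rank s(D.p y, y') < D.rank s(D.s y, y) := by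
  have h1 := D.mem_dn_up.2 (D.s_mem y hu)
  have hne : (D.up y).Nonempty := by rw [← Finset.card_pos]; omega
  have h2 := (D.p_key hne).1
  refine D.rank_dn_dn h.1 h1 ?_ (lt_of_le_of_ne (D.p_min y _ (D.s_mem y hu)) ?_)
  · have := D.lev_dn h1; have := D.lev_dn h2; omega
  · intro h3; exact D.s_ne y hu (D.idx_inj h3).symm

theorem rival_lev {c : Sym2 V → Fin (k + 5)} {x x' : V} (h : D.rival c x x') :
    D.lev x' = D.lev x := by
  rw [D.lev_dn h.2.1.1, D.lev_dn h.2.2.1.1]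

theorem rival_congr {c c' : Sym2 V → Fin (k + 5)} {x x' : V}
    (h : ∀ w, D.key (D.p x) x → D.key (D.p x) w → c s(D.p x, w) = c' s(D.p x, w)) :
    D.rival c x x' ↔ D.rival c' x x' := by
  unfold rival
  constructor
  · rintro ⟨h1, h2, h3, h4⟩
    exact ⟨h1, h2, h3, by rw [← h _ h2 h2, ← h _ h2 h3, h4]⟩
  · rintro ⟨h1, h2, h3, h4⟩
    exact ⟨h1, h2, h3, by rw [h _ h2 h2, h _ h2 h3, h4]⟩

theorem rival_congr_hd {c c' : Sym2 V → Fin (k + 5)} {x x' y : V}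
    (h : ∀ e, D.rank e < D.rank s(x, y) → c e = c' e) (hy : y ∈ D.hor x ∨ y ∈ D.dn x) :
    D.rival c x x' ↔ D.rival c' x x' := by
  apply D.rival_congr
  intro w hx hw
  apply h
  apply D.rank_key_hd hw.1 _ hy
  rw [D.lev_dn hx.1, D.lev_dn hw.1]

theorem rival_congr_s {c c' : Sym2 V → Fin (k + 5)} {y' y : V}
    (h : ∀ e, D.rank e < D.rank s(D.s y, y) → c e = c' e) (hu : 2 ≤ (D.up y).card) :
    D.rival c y y' ↔ D.rival c' y y' := by
  apply D.rival_congr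
  intro w _ hw
  exact h _ (D.rank_p_s hu hw)

theorem dsum_congr {c c' : Sym2 V → Fin (k + 5)} {x : V}
    (h : ∀ y ∈ D.dn x, c s(x, y) = c' s(x, y)) : D.dsum c x = D.dsum c' x :=
  Finset.sum_congr rfl (fun y hy => by rw [h y hy])

theorem hsum_congr {c c' : Sym2 V → Fin (k + 5)} {x : V}
    (h : ∀ y ∈ D.hor x, c s(x, y) = c' s(x, y)) : D.hsum c x = D.hsum c' x :=
  Finset.sum_congr rfl (fun y hy => by rw [h y hy])

theorem hdep (e : Sym2 V) (c c' : Sym2 V → Fin (k + 5))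
    (h : ∀ e', D.rank e' ≤ D.rank e → c e' = c' e') (hP : D.P e c) : D.P e c' := by
  intro x y he hxy
  obtain ⟨h1, h2⟩ := hP x y he hxy
  refine ⟨fun hs => by rw [← h e le_rfl]; exact h1 hs, fun hs => ?_⟩
  have hq := h2 hs
  subst he
  have hl : ∀ e', D.rank e' < D.rank s(x, y) → c e' = c' e' := fun e' he' => h e' he'.le
  have h0 := h _ le_rfl
  constructor
  · rw [← h0]; exact hq.nz
  · have := hq.maj
    unfold Pmaj at this ⊢
    convert this using 3
    unfold majc
    congr 1
    apply Finset.filter_congr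
    intro z _
    by_cases hz : D.rank s(x, z) < D.rank s(x, y)
    · simp [hz, hl _ hz, h0]
    · simp [hz]
  · intro a1 a2
    have := hq.cap a1 a2
    convert this using 2
    unfold capc
    congr 1
    apply Finset.filter_congr
    intro z _
    by_cases hz : D.rank s(x, z) < D.rank s(x, y)
    · simp [hz, hl _ hz, h0]
    · simp [hz]
  · intro a1 a2 a3
    rw [← h0, ← hl _ (D.rank_b a1.1 a1.2 a2 a3.1)]
    exact hq.bne a1 a2 a3
  · rintro rfl a2 y' a3 a4 a5
    rw [← h0, ← hl _ a5]
    exact hq.sec rfl a2 y' ((D.rival_congr_s hl a2).2 a3) a4 a5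
  · intro a1 a2 x' a3 a4
    have a3' := (D.rival_congr_hd hl (Or.inr a1)).2 a3
    have := hq.dsm a1 a2 x' a3' a4
    rwa [D.dsum_congr (c := c) (c' := c') (x := x), D.dsum_congr (c := c) (c' := c') (x := x')] at this
    · intro w hw
      exact hl _ (D.rank_dn_dn hw a1 (D.rival_lev a3) a4)
    · intro w hw
      by_cases hwy : w = D.fin x
      · rw [hwy, ← a2]; exact h0
      · rw [a2] at hl; exact hl _ (D.rank_fin hw hwy)
  · intro a1 a2 a3 x' a4 a5
    have a4' := (D.rival_congr_hd hl (Or.inl a1)).2 a4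
    have := hq.hsm a1 a2 a3 x' a4' a5
    rwa [D.hsum_congr (c := c) (c' := c') (x := x), D.hsum_congr (c := c) (c' := c') (x := x')] at this
    · intro w hw
      exact hl _ (a5 w hw)
    · intro w hw
      exact h _ (a3 w hw)

end Dat
end MDI

namespace MDI

theorem fiber_bound {A C : Type*} [DecidableEq C] [DecidableEq A] (S : Finset A) (f : A → C) (B : Finset C)
    (m n : ℕ) (h : ∀ α ∈ B, m ≤ n * (S.filter (fun z => f z = α)).card) : B.card * m ≤ n * S.card := by
  calc B.card * m = ∑ α ∈ B, m := by simp
    _ ≤ ∑ α ∈ B, n * (S.filter (fun z => f z = α)).card := Finset.sum_le_sum h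
    _ = n * ∑ α ∈ B, (S.filter (fun z => f z = α)).card := by rw [Finset.mul_sum]
    _ ≤ n * S.card := by
        apply Nat.mul_le_mul_left
        rw [Finset.sum_card_fiberwise_eq_card_filter]
        exact Finset.card_filter_le _ _

namespace Dat
variable {V : Type*} [Fintype V] [DecidableEq V] {G : SimpleGraph V} [DecidableRel G.Adj]
  (D : Dat G) {k : ℕ}

noncomputable def earl (e : Sym2 V) (x : V) : Finset V :=
  (G.neighborFinset x).filter (fun z => D.rank s(x, z) < D.rank e)

open Classical in
noncomputable def bad (T : (Sym2 V → Fin (k + 5)) → Prop) (c : Sym2 V → Fin (k + 5)) (e : Sym2 V) :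
    Finset (Fin (k + 5)) :=
  Finset.univ.filter (fun α => ¬ T (Function.update c e α))

theorem mem_bad {T : (Sym2 V → Fin (k + 5)) → Prop} {c : Sym2 V → Fin (k + 5)} {e : Sym2 V} {α} :
    α ∈ bad T c e ↔ ¬ T (Function.update c e α) := by
  simp [bad]

theorem upd_lt {c : Sym2 V → Fin (k + 5)} {e e' : Sym2 V} {α} (h : D.rank e' < D.rank e) :
    Function.update c e α e' = c e' := by
  rw [Function.update_of_ne]
  rintro rfl
  exact lt_irrefl _ h

theorem majc_upd (c : Sym2 V → Fin (k + 5)) (x y : V) (α) :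
    D.majc (Function.update c s(x, y) α) x y =
      ((D.earl s(x, y) x).filter (fun z => c s(x, z) = α)).card := by
  unfold majc earl
  rw [Finset.filter_filter]
  congr 1
  apply Finset.filter_congr
  intro z _
  by_cases hz : D.rank s(x, z) < D.rank s(x, y)
  · simp [hz, D.upd_lt hz]
  · simp [hz]

theorem bad_maj_le (hδ : ∀ v, 2 ≤ G.degree v) (c : Sym2 V → Fin (k + 5)) (x y : V) :
    (bad (fun c => D.Pmaj c x y) c s(x, y)).card ≤ (D.earl s(x, y) x).card := by
  have := fiber_bound (D.earl s(x, y) x) (fun z => c s(x, z))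
    (bad (fun c => D.Pmaj c x y) c s(x, y)) 1 1 (by
      intro α hα
      rw [mem_bad, Pmaj, D.majc_upd] at hα
      have := hδ x
      omega)
  omega

theorem bad_maj_le_two (hδ : ∀ v, 2 ≤ G.degree v) (c : Sym2 V → Fin (k + 5)) (x y : V)
    (hxy : G.Adj x y) :
    (bad (fun c => D.Pmaj c x y) c s(x, y)).card ≤ 2 := by
  have h1 := fiber_bound (D.earl s(x, y) x) (fun z => c s(x, z))
    (bad (fun c => D.Pmaj c x y) c s(x, y)) (G.degree x - 1) 2 (by
      intro α hα
      rw [mem_bad, Pmaj, D.majc_upd] at hα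
      omega)
  have h2 : (D.earl s(x, y) x).card ≤ G.degree x - 1 := by
    have : D.earl s(x, y) x ⊆ (G.neighborFinset x).erase y := by
      intro z hz
      rw [earl, Finset.mem_filter] at hz
      refine Finset.mem_erase.2 ⟨?_, hz.1⟩
      rintro rfl
      exact lt_irrefl _ hz.2
    have h3 := Finset.card_le_card this
    rwa [Finset.card_erase_of_mem (by simpa using hxy), SimpleGraph.card_neighborFinset_eq_degree] at h3
  have h4 := hδ x
  by_contra hcon
  push Not at hcon
  have h5 : 3 * (G.degree x - 1) ≤ 2 * (G.degree x - 1) :=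
    (Nat.mul_le_mul_right _ hcon).trans (h1.trans (Nat.mul_le_mul_left _ h2))
  omega

theorem earl_p {x : V} (hu : (D.up x).Nonempty) : D.earl s(D.p x, x) x = ∅ := by
  rw [Finset.eq_empty_iff_forall_notMem]
  intro z hz
  rw [earl, Finset.mem_filter, SimpleGraph.mem_neighborFinset] at hz
  by_cases h : z = D.p x
  · rw [h, Sym2.eq_swap] at hz; exact lt_irrefl _ hz.2
  · exact lt_asymm hz.2 (D.rank_p hz.1 hu h)

theorem earl_s {x : V} (hu : 2 ≤ (D.up x).card) : (D.earl s(D.s x, x) x).card ≤ 1 := by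
  have : D.earl s(D.s x, x) x ⊆ {D.p x} := by
    intro z hz
    rw [earl, Finset.mem_filter, SimpleGraph.mem_neighborFinset] at hz
    rw [Finset.mem_singleton]
    by_contra h
    by_cases h2 : z = D.s x
    · rw [h2, Sym2.eq_swap] at hz; exact lt_irrefl _ hz.2
    · exact lt_asymm hz.2 (D.rank_s hz.1 hu h h2)
  simpa using Finset.card_le_card this

theorem dn_sub (x : V) : D.dn x ⊆ G.neighborFinset x := by
  intro y hy
  rw [SimpleGraph.mem_neighborFinset]
  exact (D.mem_dn.1 hy).1

theorem card_dn_le (x : V) : (D.dn x).card ≤ G.degree x := by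
  rw [← SimpleGraph.card_neighborFinset_eq_degree]
  exact Finset.card_le_card (D.dn_sub x)

theorem bad_cap_le (hk : 2 ≤ k) (hΔ : ∀ v, G.degree v ≤ k * k) (c : Sym2 V → Fin (k + 5)) (x y : V) :
    (bad (fun c => D.Pcap c x y) c s(x, y)).card ≤ k := by
  by_cases hkey : D.key x y ∧ y ≠ D.fin x
  swap
  · have : bad (fun c => D.Pcap c x y) c s(x, y) = ∅ := by
      rw [Finset.eq_empty_iff_forall_notMem]
      intro α hα
      rw [mem_bad] at hα
      exact hα (fun a1 a2 => absurd ⟨a1, a2⟩ hkey)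
    simp [this]
  set S := (D.dn x).filter (fun z => D.p z = x ∧ D.rank s(x, z) < D.rank s(x, y)) with hS
  have h1 := fiber_bound S (fun z => c s(x, z))
    (bad (fun c => D.Pcap c x y) c s(x, y)) (k - 1) 1 (by
      intro α hα
      rw [mem_bad] at hα
      unfold Pcap at hα
      push Not at hα
      have h3 := hα.2.2
      have : D.capc (Function.update c s(x, y) α) x y = (S.filter (fun z => c s(x, z) = α)).card := by
        unfold capc
        rw [hS, Finset.filter_filter]
        congr 1
        apply Finset.filter_congr
        intro z _
        by_cases hz : D.rank s(x, z) < D.rank s(x, y)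
        · simp [hz, D.upd_lt hz]
        · simp [hz]
      rw [this] at h3
      omega)
  have hf := D.fin_mem x ⟨y, hkey.1.1⟩
  have h2 : S.card ≤ k * k - 2 := by
    have : S ⊆ ((D.dn x).erase y).erase (D.fin x) := by
      intro z hz
      rw [hS, Finset.mem_filter] at hz
      refine Finset.mem_erase.2 ⟨?_, Finset.mem_erase.2 ⟨?_, hz.1⟩⟩
      · rintro rfl
        exact lt_asymm hz.2.2 (D.rank_fin hkey.1.1 hkey.2)
      · rintro rfl
        exact lt_irrefl _ hz.2.2
    have h3 := Finset.card_le_card this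
    rw [Finset.card_erase_of_mem (Finset.mem_erase.2 ⟨fun h => hkey.2 h.symm, hf⟩),
      Finset.card_erase_of_mem hkey.1.1] at h3
    have := D.card_dn_le x
    have := hΔ x
    omega
  by_contra hcon
  push Not at hcon
  have h5 : (k + 1) * (k - 1) ≤ k * k - 2 :=
    (Nat.mul_le_mul_right _ hcon).trans (h1.trans (by omega))
  obtain ⟨m, rfl⟩ : ∃ m, k = m + 2 := ⟨k - 2, by omega⟩
  have h6 : m + 2 - 1 = m + 1 := rfl
  rw [h6] at h5
  have h7 : 2 ≤ (m + 2) * (m + 2) := by nlinarith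
  zify [h7] at h5
  nlinarith

theorem bad_eq_empty {T : (Sym2 V → Fin (k + 5)) → Prop} {c : Sym2 V → Fin (k + 5)} {e : Sym2 V}
    (h : ∀ α, T (Function.update c e α)) : (bad T c e).card = 0 := by
  rw [Finset.card_eq_zero, Finset.eq_empty_iff_forall_notMem]
  intro α hα
  exact mem_bad.1 hα (h α)

theorem bad_bne_le (c : Sym2 V → Fin (k + 5)) (x y : V) :
    (bad (fun c => D.Pbne c x y) c s(x, y)).card ≤ 1 := by
  have : bad (fun c => D.Pbne c x y) c s(x, y) ⊆ {c s(x, D.b y)} := by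
    intro α hα
    rw [mem_bad] at hα
    unfold Pbne at hα
    push Not at hα
    obtain ⟨h1, h2, h3, h4⟩ := hα
    rw [D.upd_lt (D.rank_b h1.1 h1.2 h2 h3.1), Function.update_self] at h4
    simpa using h4
  simpa using Finset.card_le_card this

open Classical in
noncomputable def rivals (c : Sym2 V → Fin (k + 5)) (x : V) : Finset V :=
  Finset.univ.filter (fun x' => D.rival c x x')

theorem mem_rivals {c : Sym2 V → Fin (k + 5)} {x x' : V} : x' ∈ D.rivals c x ↔ D.rival c x x' := by
  simp [rivals]

theorem group_le (hk : 2 ≤ k) (c : Sym2 V → Fin (k + 5)) (v : V) (α)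
    (hP : ∀ w, D.key v w → D.P s(v, w) c) :
    ((D.dn v).filter (fun w => D.p w = v ∧ c s(v, w) = α)).card ≤ k := by
  set S := (D.dn v).filter (fun w => D.p w = v ∧ c s(v, w) = α) with hS
  have hmem : ∀ w ∈ S, D.key v w ∧ c s(v, w) = α := by
    intro w hw
    rw [hS, Finset.mem_filter] at hw
    exact ⟨⟨hw.1, hw.2.1⟩, hw.2.2⟩
  by_cases hα : α = 0
  · have : S ⊆ {D.t1, D.t2} := by
      intro w hw
      obtain ⟨h1, h2⟩ := hmem w hw
      have hl := (D.mem_dn.1 h1.1)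
      have h3 := hP w h1 v w rfl hl.1
      by_cases hs : D.sp s(v, w)
      · rcases hs with hs | hs
        · rw [Sym2.eq_iff] at hs
          rcases hs with ⟨_, h⟩ | ⟨_, h⟩
          · simp [h]
          · exfalso; have := D.lev_r; rw [h] at hl; omega
        · rw [Sym2.eq_iff] at hs
          rcases hs with ⟨_, h⟩ | ⟨_, h⟩
          · simp [h]
          · exfalso; have := D.lev_r; rw [h] at hl; omega
      · exact absurd (h2.trans hα) (h3.2 hs).nz
    exact (Finset.card_le_card this).trans (Finset.card_le_two.trans hk)
  · have hb : (S.erase (D.fin v)).card ≤ k - 1 := by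
      rcases (S.erase (D.fin v)).eq_empty_or_nonempty with h0 | h0
      · simp [h0]
      obtain ⟨m, hm, hmax⟩ := Finset.exists_max_image _ (fun w => D.rank s(v, w)) h0
      have hm2 := Finset.mem_erase.1 hm
      obtain ⟨h1, h2⟩ := hmem m hm2.2
      have h3 := hP m h1 v m rfl (D.mem_dn.1 h1.1).1
      have hns : ¬ D.sp s(v, m) := fun hs => hα (h2.symm.trans (h3.1 hs))
      have h4 := (h3.2 hns).cap h1 hm2.1
      have h5 : (S.erase (D.fin v)).erase m ⊆ ((D.dn v).filter
          (fun z => D.p z = v ∧ c s(v, z) = c s(v, m) ∧ D.rank s(v, z) < D.rank s(v, m))) := by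
        intro z hz
        have hz1 := Finset.mem_erase.1 hz
        have hz2 := Finset.mem_erase.1 hz1.2
        obtain ⟨a1, a2⟩ := hmem z hz2.2
        refine Finset.mem_filter.2 ⟨a1.1, a1.2, a2.trans h2.symm, ?_⟩
        refine lt_of_le_of_ne (hmax z hz1.2) ?_
        intro h
        exact hz1.1 (Sym2.congr_right.1 (D.rank_inj h))
      have h6 := Finset.card_le_card h5
      rw [Finset.card_erase_of_mem hm] at h6
      unfold capc at h4
      omega
    have := Finset.pred_card_le_card_erase (s := S) (a := D.fin v)
    omega

theorem rivals_le (hk : 2 ≤ k) (c : Sym2 V → Fin (k + 5)) (x : V)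
    (hP : ∀ w, D.key (D.p x) x → D.key (D.p x) w → D.P s(D.p x, w) c) :
    (D.rivals c x).card ≤ k - 1 := by
  by_cases hx : D.key (D.p x) x
  swap
  · have : D.rivals c x = ∅ := by
      rw [Finset.eq_empty_iff_forall_notMem]
      intro z hz
      rw [mem_rivals] at hz
      exact hx hz.2.1
    simp [this]
  have h1 := D.group_le hk c (D.p x) (c s(D.p x, x)) (fun w hw => hP w hx hw)
  have h2 : D.rivals c x ⊆
      ((D.dn (D.p x)).filter (fun w => D.p w = D.p x ∧ c s(D.p x, w) = c s(D.p x, x))).erase x := by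
    intro z hz
    rw [mem_rivals] at hz
    obtain ⟨a1, a2, a3, a4⟩ := hz
    exact Finset.mem_erase.2 ⟨a1, Finset.mem_filter.2 ⟨a3.1, a3.2, a4⟩⟩
  have h3 := Finset.card_le_card h2
  rw [Finset.card_erase_of_mem (Finset.mem_filter.2 ⟨hx.1, rfl, rfl⟩)] at h3
  omega

theorem bad_sec_le (c : Sym2 V → Fin (k + 5)) (x y : V) :
    (bad (fun c => D.Psec c x y) c s(x, y)).card ≤ (D.rivals c y).card := by
  refine card_le_of_rel _ _ (fun α y' => α = c s(x, y')) ?_ (fun a a' x h h' => h.trans h'.symm)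
  intro α hα
  rw [mem_bad] at hα
  unfold Psec at hα
  push Not at hα
  obtain ⟨rfl, h2, y', h3, h4, h5, h6⟩ := hα
  rw [D.upd_lt h5, Function.update_self] at h6
  refine ⟨y', ?_, h6⟩
  rw [mem_rivals]
  exact ((D.rival_congr_s (fun e he => D.upd_lt he) h2).1 h3)

theorem bad_dsm_le (c : Sym2 V → Fin (k + 5)) (x y : V) :
    (bad (fun c => D.Pdsm c x y) c s(x, y)).card ≤ (D.rivals c x).card := by
  refine card_le_of_rel _ _ (fun α x' => D.dsum c x' = α.val +
    ∑ w ∈ (D.dn x).erase y, (c s(x, w)).val) ?_ (fun a a' x h h' => Fin.ext (by omega))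
  intro α hα
  rw [mem_bad] at hα
  unfold Pdsm at hα
  push Not at hα
  obtain ⟨h1, h2, x', h3, h4, h5⟩ := hα
  refine ⟨x', ?_, ?_⟩
  · rw [mem_rivals]
    exact ((D.rival_congr_hd (fun e he => D.upd_lt he) (Or.inr h1)).1 h3)
  · rw [D.dsum_congr (c := Function.update c s(x, y) α) (c' := c)] at h5
    · rw [h5, dsum, ← Finset.add_sum_erase _ _ h1, Function.update_self]
      congr 1
      apply Finset.sum_congr rfl
      intro w hw
      rw [Function.update_of_ne]
      intro h
      exact (Finset.mem_erase.1 hw).1 (Sym2.congr_right.1 h)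
    · intro w hw
      exact D.upd_lt (D.rank_dn_dn hw h1 (D.rival_lev h3) h4)

theorem bad_hsm_le (c : Sym2 V → Fin (k + 5)) (x y : V) :
    (bad (fun c => D.Phsm c x y) c s(x, y)).card ≤ (D.rivals c x).card := by
  refine card_le_of_rel _ _ (fun α x' => D.hsum c x' = α.val +
    ∑ w ∈ (D.hor x).erase y, (c s(x, w)).val) ?_ (fun a a' x h h' => Fin.ext (by omega))
  intro α hα
  rw [mem_bad] at hα
  unfold Phsm at hα
  push Not at hα
  obtain ⟨h1, h2, h2', x', h3, h4, h5⟩ := hα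
  refine ⟨x', ?_, ?_⟩
  · rw [mem_rivals]
    exact ((D.rival_congr_hd (fun e he => D.upd_lt he) (Or.inl h1)).1 h3)
  · rw [D.hsum_congr (c := Function.update c s(x, y) α) (c' := c)] at h5
    · rw [h5, hsum, ← Finset.add_sum_erase _ _ h1, Function.update_self]
      congr 1
      apply Finset.sum_congr rfl
      intro w hw
      rw [Function.update_of_ne]
      intro h
      exact (Finset.mem_erase.1 hw).1 (Sym2.congr_right.1 h)
    · intro w hw
      exact D.upd_lt (h4 w hw)

end Dat
end MDI

namespace MDI
namespace Dat
variable {V : Type*} [Fintype V] [DecidableEq V] {G : SimpleGraph V} [DecidableRel G.Adj]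
  (D : Dat G) {k : ℕ}

theorem last_near {x y : V} (h : y ∈ D.hor x) (hx : x ≠ D.snk x)
    (hlast : ∀ z ∈ D.hor x, D.rank s(x, z) ≤ D.rank s(x, y)) : D.d y < D.d x := by
  obtain ⟨z, hz, hd⟩ := D.d_near x hx
  have hz' : z ∈ D.hor x := D.mem_hor.2 hz
  by_contra hcon
  have : D.rank s(x, y) < D.rank s(x, z) := by
    apply D.rank_ter
    · rw [D.prim_hor h, D.prim_hor hz']
    · rw [D.scnd_hor h, D.scnd_hor hz']
    · rw [D.ter_hor h, D.ter_hor hz']; omega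
  exact absurd (hlast z hz') (not_le.2 this)

theorem sp_low {v y : V} (hs : D.sp s(v, y)) (hy : y ∈ D.dn v) :
    v = D.r ∧ (y = D.t1 ∨ y = D.t2) := by
  have h1 := D.mem_dn.1 hy
  have h0 := D.lev_r
  rcases hs with hs | hs <;> rw [Sym2.eq_iff] at hs <;> rcases hs with ⟨a, b⟩ | ⟨a, b⟩
  · exact ⟨a, Or.inl b⟩
  · rw [b] at h1; omega
  · exact ⟨a, Or.inr b⟩
  · rw [b] at h1; omega

theorem up_one {y : V} (hy : y ∈ D.dn D.r) : (D.up y).card ≤ 1 := by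
  have h1 := D.lev_dn hy
  have : D.up y ⊆ {D.r} := by
    intro u hu
    rw [D.mem_up] at hu
    rw [Finset.mem_singleton]
    apply D.lev_zero
    have := D.lev_r
    omega
  simpa using Finset.card_le_card this

theorem not_sp_A {v y : V} (hy : y ∈ D.dn v) (hu : 2 ≤ (D.up y).card) : ¬ D.sp s(v, y) := by
  intro hs
  have h := D.sp_low hs hy
  rw [h.1] at hy
  have := D.up_one hy
  omega

theorem bad_sec_b (c : Sym2 V → Fin (k + 5)) (x y : V) (hb : D.b y = y)
    (hP : ∀ w, D.key (D.p y) w → D.rank s(D.p y, w) < D.rank s(x, y) → D.P s(D.p y, w) c) :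
    (bad (fun c => D.Psec c x y) c s(x, y)).card = 0 := by
  apply bad_eq_empty
  rintro α rfl h2 y' h3 h4 h5
  exfalso
  have h3' := (D.rival_congr_s (fun e he => D.upd_lt he) h2).1 h3
  obtain ⟨a1, a2, a3, a4⟩ := h3'
  have h6 := (hP y' a3 (D.rank_p_s h2 a3) _ _ rfl (D.mem_dn.1 a3.1).1).2
    (D.not_sp_A a3.1 (by rw [h4]; exact h2))
  have hb' : D.b y' = y := by rw [← D.b_congr y y' h2 h4.symm, hb]
  have := h6.bne a3 (by rw [hb']; exact a1.symm) (by rw [hb']; exact a2)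
  rw [hb'] at this
  exact this a4

theorem hext (hk : 2 ≤ k) (hδ : ∀ v, 2 ≤ G.degree v) (hΔ : ∀ v, G.degree v ≤ k * k)
    (e : Sym2 V) (c : Sym2 V → Fin (k + 5))
    (hP : ∀ e', D.rank e' < D.rank e → D.P e' c) : ∃ α, D.P e (Function.update c e α) := by
  by_cases hs : D.sp e
  · refine ⟨0, ?_⟩
    intro x y _ _
    exact ⟨fun _ => Function.update_self _ _ _, fun h => absurd hs h⟩
  by_cases hadj : ∃ x y, e = s(x, y) ∧ G.Adj x y ∧ D.lev x ≤ D.lev y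
  swap
  · refine ⟨0, ?_⟩
    intro x y he hxy
    exfalso
    apply hadj
    rcases le_total (D.lev x) (D.lev y) with h | h
    · exact ⟨x, y, he, hxy, h⟩
    · exact ⟨y, x, by rw [he, Sym2.eq_swap], hxy.symm, h⟩
  obtain ⟨x, y, rfl, hxy, hle⟩ := hadj
  suffices h : ∃ α, D.Q (Function.update c s(x, y) α) x y ∧ D.Q (Function.update c s(x, y) α) y x by
    obtain ⟨α, h1, h2⟩ := h
    refine ⟨α, ?_⟩
    intro x' y' he _
    refine ⟨fun h => absurd h hs, fun _ => ?_⟩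
    rw [Sym2.eq_iff] at he
    rcases he with ⟨rfl, rfl⟩ | ⟨rfl, rfl⟩
    · exact h1
    · exact h2
  have hmx := D.bad_maj_le_two hδ c x y hxy
  have hmy := D.bad_maj_le_two hδ c y x hxy.symm
  have hmy' := D.bad_maj_le hδ c y x
  rw [Sym2.eq_swap (a := y)] at hmy hmy'
  by_contra hcon
  push Not at hcon
  rcases hle.lt_or_eq with hlt | heq
  · -- vertical edge
    have hdn : y ∈ D.dn x := D.mem_dn.2 ⟨hxy, hlt⟩
    have hup : x ∈ D.up y := D.mem_dn_up.1 hdn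
    have hupne : (D.up y).Nonempty := ⟨x, hup⟩
    have hsub : (Finset.univ : Finset (Fin (k + 5))) ⊆
        {0} ∪ bad (fun c => D.Pmaj c x y) c s(x, y) ∪ bad (fun c => D.Pmaj c y x) c s(x, y) ∪
        bad (fun c => D.Pcap c x y) c s(x, y) ∪ bad (fun c => D.Pbne c x y) c s(x, y) ∪
        bad (fun c => D.Psec c x y) c s(x, y) ∪ bad (fun c => D.Pdsm c x y) c s(x, y) := by
      intro α _
      simp only [Finset.mem_union, mem_bad, Finset.mem_singleton]
      by_contra hno
      push Not at hno
      obtain ⟨⟨⟨⟨⟨⟨g0, g1⟩, g2⟩, g3⟩, g4⟩, g5⟩, g6⟩ := hno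
      have hny : x ∉ D.dn y := by rw [D.mem_dn]; omega
      refine hcon α ⟨by rwa [Function.update_self], g1, g3, g4, g5, g6, ?_⟩
        ⟨by rwa [Sym2.eq_swap, Function.update_self], g2, ?_, ?_, ?_, ?_, ?_⟩
      · intro h; exfalso; rw [D.mem_hor] at h; omega
      · intro h; exact absurd h.1 hny
      · intro h; exact absurd h.1 hny
      · intro h h2
        exact absurd (D.mem_dn_up.2 (h ▸ D.s_mem x h2)) hny
      · intro h; exact absurd h hny
      · intro h; exfalso; rw [D.mem_hor] at h; omega
    have hcard := Finset.card_le_card hsub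
    have u1 := Finset.card_union_le ({0} ∪ bad (fun c => D.Pmaj c x y) c s(x, y) ∪ bad (fun c => D.Pmaj c y x) c s(x, y) ∪
        bad (fun c => D.Pcap c x y) c s(x, y) ∪ bad (fun c => D.Pbne c x y) c s(x, y) ∪
        bad (fun c => D.Psec c x y) c s(x, y)) (bad (fun c => D.Pdsm c x y) c s(x, y))
    have u2 := Finset.card_union_le ({0} ∪ bad (fun c => D.Pmaj c x y) c s(x, y) ∪ bad (fun c => D.Pmaj c y x) c s(x, y) ∪
        bad (fun c => D.Pcap c x y) c s(x, y) ∪ bad (fun c => D.Pbne c x y) c s(x, y))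
        (bad (fun c => D.Psec c x y) c s(x, y))
    have u3 := Finset.card_union_le ({0} ∪ bad (fun c => D.Pmaj c x y) c s(x, y) ∪ bad (fun c => D.Pmaj c y x) c s(x, y) ∪
        bad (fun c => D.Pcap c x y) c s(x, y)) (bad (fun c => D.Pbne c x y) c s(x, y))
    have u4 := Finset.card_union_le ({0} ∪ bad (fun c => D.Pmaj c x y) c s(x, y) ∪ bad (fun c => D.Pmaj c y x) c s(x, y))
        (bad (fun c => D.Pcap c x y) c s(x, y))
    have u5 := Finset.card_union_le ({0} ∪ bad (fun c => D.Pmaj c x y) c s(x, y)) (bad (fun c => D.Pmaj c y x) c s(x, y))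
    have u6 := Finset.card_union_le {0} (bad (fun c => D.Pmaj c x y) c s(x, y))
    rw [Finset.card_univ, Fintype.card_fin] at hcard
    rw [Finset.card_singleton] at u6
    have hcap := D.bad_cap_le hk hΔ c x y
    have hbne := D.bad_bne_le c x y
    have hdsm : (bad (fun c => D.Pdsm c x y) c s(x, y)).card ≤ k - 1 := by
      refine (D.bad_dsm_le c x y).trans (D.rivals_le hk c x ?_)
      intro w h1 h2
      apply hP
      apply D.rank_key_hd h2.1 _ (Or.inr hdn)
      rw [D.lev_dn h1.1, D.lev_dn h2.1]
    have hdsm0 : y ≠ D.fin x → (bad (fun c => D.Pdsm c x y) c s(x, y)).card = 0 := by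
      intro h
      exact bad_eq_empty (fun α _ h2 => absurd h2 h)
    have hsec0 : ¬ (x = D.s y ∧ 2 ≤ (D.up y).card) →
        (bad (fun c => D.Psec c x y) c s(x, y)).card = 0 := by
      intro h
      exact bad_eq_empty (fun α h1 h2 => absurd ⟨h1, h2⟩ h)
    have hcap0 : ¬ (D.p y = x ∧ y ≠ D.fin x) →
        (bad (fun c => D.Pcap c x y) c s(x, y)).card = 0 := by
      intro h
      exact bad_eq_empty (fun α h1 h2 => absurd ⟨h1.2, h2⟩ h)
    have hbne0 : D.p y ≠ x →
        (bad (fun c => D.Pbne c x y) c s(x, y)).card = 0 := by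
      intro h
      exact bad_eq_empty (fun α h1 => absurd h1.2 h)
    by_cases hp : D.p y = x
    · have hs0 := hsec0 (by
        rintro ⟨h1, h2⟩
        exact D.s_ne y h2 (by rw [← h1, hp]))
      have hm0 : (D.earl s(x, y) y).card = 0 := by
        rw [← hp, D.earl_p hupne, Finset.card_empty]
      by_cases hf : y = D.fin x
      · have := hcap0 (fun h => h.2 hf)
        omega
      · have := hdsm0 hf
        omega
    · have hc0 := hcap0 (fun h => hp h.1)
      have hb0 := hbne0 hp
      by_cases hss : x = D.s y ∧ 2 ≤ (D.up y).card
      · have hm1 : (D.earl s(x, y) y).card ≤ 1 := by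
          rw [hss.1]; exact D.earl_s hss.2
        by_cases hf : y = D.fin x
        · have hb : D.b y = y := by
            rcases D.fin_spec x ⟨y, hdn⟩ with h | h
            · rw [← hf] at h; exact absurd h.1 hp
            · rw [← hf] at h; exact h.1
          have := D.bad_sec_b c x y hb (fun w _ h => hP _ h)
          omega
        · have h0 := hdsm0 hf
          have : (bad (fun c => D.Psec c x y) c s(x, y)).card ≤ k - 1 := by
            refine (D.bad_sec_le c x y).trans (D.rivals_le hk c y ?_)
            intro w _ h2
            apply hP
            rw [hss.1]
            exact D.rank_p_s hss.2 h2
          omega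
      · have := hsec0 hss
        omega
  · -- horizontal edge
    have hh : y ∈ D.hor x := D.mem_hor.2 ⟨hxy, heq⟩
    have hh' : x ∈ D.hor y := D.mem_hor.2 ⟨hxy.symm, heq.symm⟩
    have hsub : (Finset.univ : Finset (Fin (k + 5))) ⊆
        {0} ∪ bad (fun c => D.Pmaj c x y) c s(x, y) ∪ bad (fun c => D.Pmaj c y x) c s(x, y) ∪
        bad (fun c => D.Phsm c x y) c s(x, y) ∪ bad (fun c => D.Phsm c y x) c s(x, y) := by
      intro α _
      simp only [Finset.mem_union, mem_bad, Finset.mem_singleton]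
      by_contra hno
      push Not at hno
      obtain ⟨⟨⟨⟨g0, g1⟩, g2⟩, g3⟩, g4⟩ := hno
      have hny : x ∉ D.dn y := by rw [D.mem_dn]; omega
      have hnx : y ∉ D.dn x := by rw [D.mem_dn]; omega
      refine hcon α ⟨by rwa [Function.update_self], g1, ?_, ?_, ?_, ?_, g3⟩
        ⟨by rwa [Sym2.eq_swap, Function.update_self], g2, ?_, ?_, ?_, ?_, g4⟩
      · intro h; exact absurd h.1 hnx
      · intro h; exact absurd h.1 hnx
      · intro h h2
        exact absurd (D.mem_dn_up.2 (h ▸ D.s_mem y h2)) hnx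
      · intro h; exact absurd h hnx
      · intro h; exact absurd h.1 hny
      · intro h; exact absurd h.1 hny
      · intro h h2
        exact absurd (D.mem_dn_up.2 (h ▸ D.s_mem x h2)) hny
      · intro h; exact absurd h hny
    have hcard := Finset.card_le_card hsub
    have u3 := Finset.card_union_le ({0} ∪ bad (fun c => D.Pmaj c x y) c s(x, y) ∪ bad (fun c => D.Pmaj c y x) c s(x, y) ∪
        bad (fun c => D.Phsm c x y) c s(x, y)) (bad (fun c => D.Phsm c y x) c s(x, y))
    have u4 := Finset.card_union_le ({0} ∪ bad (fun c => D.Pmaj c x y) c s(x, y) ∪ bad (fun c => D.Pmaj c y x) c s(x, y))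
        (bad (fun c => D.Phsm c x y) c s(x, y))
    have u5 := Finset.card_union_le ({0} ∪ bad (fun c => D.Pmaj c x y) c s(x, y)) (bad (fun c => D.Pmaj c y x) c s(x, y))
    have u6 := Finset.card_union_le {0} (bad (fun c => D.Pmaj c x y) c s(x, y))
    rw [Finset.card_univ, Fintype.card_fin] at hcard
    rw [Finset.card_singleton] at u6
    have hx1 : (bad (fun c => D.Phsm c x y) c s(x, y)).card ≤ k - 1 := by
      refine (D.bad_hsm_le c x y).trans (D.rivals_le hk c x ?_)
      intro w h1 h2
      apply hP
      apply D.rank_key_hd h2.1 _ (Or.inl hh)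
      rw [D.lev_dn h1.1, D.lev_dn h2.1]
    have hy1 : (bad (fun c => D.Phsm c y x) c s(x, y)).card ≤ k - 1 := by
      have := D.bad_hsm_le c y x
      rw [Sym2.eq_swap (a := y)] at this
      refine this.trans (D.rivals_le hk c y ?_)
      intro w h1 h2
      apply hP
      apply D.rank_key_hd h2.1 _ (Or.inl hh)
      rw [heq, D.lev_dn h1.1, D.lev_dn h2.1]
    rcases lt_or_ge (D.d y) (D.d x) with hd | hd
    · have : (bad (fun c => D.Phsm c y x) c s(x, y)).card = 0 := by
        apply bad_eq_empty
        intro α a1 a2 a3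
        have := D.last_near a1 a2 a3
        omega
      omega
    · have : (bad (fun c => D.Phsm c x y) c s(x, y)).card = 0 := by
        apply bad_eq_empty
        intro α a1 a2 a3
        have := D.last_near a1 a2 a3
        omega
      omega

theorem exists_col (hk : 2 ≤ k) (hδ : ∀ v, 2 ≤ G.degree v) (hΔ : ∀ v, G.degree v ≤ k * k) :
    ∃ c : Sym2 V → Fin (k + 5), ∀ e, D.P e c :=
  greedy D.rank D.rank_inj D.P D.hdep (D.hext hk hδ hΔ)

end Dat
end MDI

namespace MDI
namespace Dat
variable {V : Type*} [Fintype V] [DecidableEq V] {G : SimpleGraph V} [DecidableRel G.Adj]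
  (D : Dat G) {k : ℕ}

theorem zero_sp {c : Sym2 V → Fin (k + 5)} (hP : ∀ e, D.P e c) {x y : V} (h : G.Adj x y)
    (h0 : c s(x, y) = 0) : D.sp s(x, y) := by
  by_contra hs
  exact ((hP _ x y rfl h).2 hs).nz h0

theorem sp_zero {c : Sym2 V → Fin (k + 5)} (hP : ∀ e, D.P e c) {x y : V} (h : G.Adj x y)
    (h0 : D.sp s(x, y)) : c s(x, y) = 0 := (hP _ x y rfl h).1 h0

theorem majority {c : Sym2 V → Fin (k + 5)} (hP : ∀ e, D.P e c) (hδ : ∀ v, 2 ≤ G.degree v)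
    (hr : 4 ≤ G.degree D.r) (u : V) (α : Fin (k + 5)) :
    2 * ((G.neighborFinset u).filter (fun v => c s(u, v) = α)).card ≤ G.degree u := by
  by_cases hα : α = 0
  · subst hα
    by_cases hu : u = D.r
    · subst hu
      have : ((G.neighborFinset D.r).filter (fun v => c s(D.r, v) = 0)) ⊆ {D.t1, D.t2} := by
        intro v hv
        rw [Finset.mem_filter, mem_neighborFinset] at hv
        have := D.zero_sp hP hv.1 hv.2
        have hne := hv.1.ne
        unfold sp at this
        simp only [Sym2.eq_iff] at this
        simp only [Finset.mem_insert, Finset.mem_singleton]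
        grind
      have h1 := Finset.card_le_card this
      have h2 : ({D.t1, D.t2} : Finset V).card ≤ 2 := Finset.card_le_two
      omega
    · have : ((G.neighborFinset u).filter (fun v => c s(u, v) = 0)) ⊆ {D.r} := by
        intro v hv
        rw [Finset.mem_filter, mem_neighborFinset] at hv
        have := D.zero_sp hP hv.1 hv.2
        unfold sp at this
        simp only [Sym2.eq_iff] at this
        simp only [Finset.mem_singleton]
        grind
      have h1 := Finset.card_le_card this
      have h2 := hδ u
      simp only [Finset.card_singleton] at h1
      omega
  · set S := (G.neighborFinset u).filter (fun v => c s(u, v) = α) with hS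
    rcases S.eq_empty_or_nonempty with h | h
    · rw [h]; simp
    · obtain ⟨z, hz, hmax⟩ := S.exists_max_image (fun z => D.rank s(u, z)) h
      have hz' := hz
      rw [hS, Finset.mem_filter, mem_neighborFinset] at hz'
      have hns : ¬ D.sp s(u, z) := by
        intro hs
        exact hα (by rw [← hz'.2]; exact D.sp_zero hP hz'.1 hs)
      have hm := ((hP _ u z rfl hz'.1).2 hns).maj
      unfold Pmaj majc at hm
      have hsub : S.erase z ⊆ (G.neighborFinset u).filter
          (fun w => c s(u, w) = c s(u, z) ∧ D.rank s(u, w) < D.rank s(u, z)) := by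
        intro w hw
        rw [Finset.mem_erase] at hw
        have hw2 := hw.2
        rw [hS, Finset.mem_filter] at hw2
        rw [Finset.mem_filter]
        refine ⟨hw2.1, by rw [hw2.2, hz'.2], lt_of_le_of_ne (hmax w hw.2) ?_⟩
        intro he
        have := D.rank_inj he
        rw [Sym2.congr_right] at this
        exact hw.1 this
      have h1 := Finset.card_le_card hsub
      rw [Finset.card_erase_of_mem hz] at h1
      omega

theorem rival_symm {c : Sym2 V → Fin (k + 5)} {x x' : V} (h : D.rival c x x') :
    D.rival c x' x := by
  obtain ⟨h1, h2, h3, h4⟩ := h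
  have := h3.2
  refine ⟨h1.symm, ?_, ?_, ?_⟩
  · rw [this]; exact h3
  · rw [this]; exact h2
  · rw [this]; exact h4.symm

theorem not_sp_hor {x y : V} (h : y ∈ D.hor x) : ¬ D.sp s(x, y) := by
  intro hs
  have h1 := D.mem_hor.1 h
  have h0 := D.lev_r
  have hne := h1.1.ne
  have key : ∀ z, D.lev z = 0 → z = D.r := D.lev_zero
  rcases hs with hs | hs <;> rw [Sym2.eq_iff] at hs <;> rcases hs with ⟨a, b⟩ | ⟨a, b⟩
  all_goals
    have := key x (by have := h1.2; grind)
    have := key y (by have := h1.2; grind)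
    grind

theorem exists_last {x : V} (h : x ≠ D.snk x) :
    ∃ y ∈ D.hor x, ∀ z ∈ D.hor x, D.rank s(x, z) ≤ D.rank s(x, y) := by
  obtain ⟨z, hz, _⟩ := D.d_near x h
  have hz' : z ∈ D.hor x := D.mem_hor.2 hz
  exact (D.hor x).exists_max_image (fun z => D.rank s(x, z)) ⟨z, hz'⟩

theorem hor_contra1 {c : Sym2 V → Fin (k + 5)} (hP : ∀ e, D.P e c) {x x' y : V}
    (hr : D.rival c x x') (hs : D.hsum c x' = D.hsum c x) (hx : x ≠ D.snk x)
    (hy : y ∈ D.hor x) (hl : ∀ z ∈ D.hor x, D.rank s(x, z) ≤ D.rank s(x, y))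
    (hl' : ∀ z ∈ D.hor x', D.rank s(x', z) < D.rank s(x, y)) : False :=
  ((hP _ x y rfl (D.mem_hor.1 hy).1).2 (D.not_sp_hor hy)).hsm hy hx hl x' hr hl' hs

theorem hor_contra {c : Sym2 V → Fin (k + 5)} (hP : ∀ e, D.P e c) {x x' : V}
    (hr : D.rival c x x') (hs : D.hsum c x' = D.hsum c x) (hx : x ≠ D.snk x)
    (hx' : x' ≠ D.snk x') : False := by
  obtain ⟨y, hy, hl⟩ := D.exists_last hx
  obtain ⟨y', hy', hl'⟩ := D.exists_last hx'
  have hd := D.last_near hy hx hl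
  have hd' := D.last_near hy' hx' hl'
  rcases lt_trichotomy (D.rank s(x, y)) (D.rank s(x', y')) with h | h | h
  · exact D.hor_contra1 hP (D.rival_symm hr) hs.symm hx' hy' hl'
      (fun z hz => (hl z hz).trans_lt h)
  · have := D.rank_inj h
    rw [Sym2.eq_iff] at this
    rcases this with ⟨a, b⟩ | ⟨a, b⟩
    · exact hr.1 a.symm
    · rw [a, b] at hd; omega
  · exact D.hor_contra1 hP hr hs hx hy hl (fun z hz => (hl' z hz).trans_lt h)

/-- different horizontal components -/
theorem hor_contra2 {c : Sym2 V → Fin (k + 5)} (hP : ∀ e, D.P e c) {x x' : V}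
    (hr : D.rival c x x') (hs : D.hsum c x' = D.hsum c x) (hx : x ≠ D.snk x)
    (hi : D.idx (D.snk x') < D.idx (D.snk x)) : False := by
  obtain ⟨y, hy, hl⟩ := D.exists_last hx
  refine D.hor_contra1 hP hr hs hx hy hl (fun z hz => ?_)
  apply D.rank_scnd
  · rw [D.prim_hor hy, D.prim_hor hz, D.rival_lev hr]
  · rw [D.scnd_hor hy, D.scnd_hor hz]; omega

theorem dn_contra1 {c : Sym2 V → Fin (k + 5)} (hP : ∀ e, D.P e c) {x x' : V}
    (hr : D.rival c x x') (hs : D.dsum c x' = D.dsum c x) (hx : (D.dn x).Nonempty)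
    (hi : D.idx x' < D.idx x) : False := by
  have hf := D.fin_mem x hx
  refine ((hP _ x (D.fin x) rfl (D.mem_dn.1 hf).1).2 ?_).dsm hf rfl x' hr hi hs
  intro h
  have := (D.sp_low h hf).1
  have h1 := D.lev_dn hr.2.1.1
  have := D.lev_r
  grind

theorem dn_contra {c : Sym2 V → Fin (k + 5)} (hP : ∀ e, D.P e c) {x x' : V}
    (hr : D.rival c x x') (hs : D.dsum c x' = D.dsum c x) (hx : (D.dn x).Nonempty)
    (hx' : (D.dn x').Nonempty) : False := by
  rcases lt_trichotomy (D.idx x') (D.idx x) with h | h | h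
  · exact D.dn_contra1 hP hr hs hx h
  · exact hr.1 (D.idx_inj h)
  · exact D.dn_contra1 hP (D.rival_symm hr) hs.symm hx' h

theorem A_contra {c : Sym2 V → Fin (k + 5)} (hP : ∀ e, D.P e c) {x x' : V}
    (hr : D.rival c x x') (hu : D.up x' = D.up x) (hA : 2 ≤ (D.up x).card)
    (hc : c s(D.s x, x') = c s(D.s x, x)) : False := by
  have hs : D.s x' = D.s x := D.s_congr _ _ hu
  have h1 := D.mem_dn_up.2 (D.s_mem x hA)
  have h2 := D.mem_dn_up.2 (D.s_mem x' (by rw [← Dat.up, hu]; exact hA))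
  rw [hs] at h2
  rcases lt_trichotomy (D.rank s(D.s x, x')) (D.rank s(D.s x, x)) with h | h | h
  · exact ((hP _ _ _ rfl (D.mem_dn.1 h1).1).2 (D.not_sp_A h1 hA)).sec rfl hA x' hr hu h hc.symm
  · have := D.rank_inj h
    rw [Sym2.congr_right] at this
    exact hr.1 this
  · exact ((hP _ _ _ rfl (D.mem_dn.1 h2).1).2 (D.not_sp_A h2 (by rw [hu]; exact hA))).sec hs.symm
      (by rw [hu]; exact hA) x (D.rival_symm hr) hu.symm h hc

/-- the rival is the sink of the own component -/
theorem snk_contra {c : Sym2 V → Fin (k + 5)} (hP : ∀ e, D.P e c) {x x' : V}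
    (hr : D.rival c x x') (hu : D.up x' = D.up x) (h1 : (D.up x).card ≤ 1)
    (hx : D.snk x = x') : False := by
  have hb : D.b x = x' := by
    rw [← hx]; exact D.b_low x h1 (by rw [hx, ← Dat.up, hu]; exact h1)
  obtain ⟨a1, a2, a3, a4⟩ := hr
  have hadj := (D.mem_dn.1 a2.1).1
  have hadj' := (D.mem_dn.1 a3.1).1
  by_cases hs : D.sp s(D.p x, x)
  · have h0 := D.sp_zero hP hadj hs
    have hs' := D.zero_sp hP hadj' (a4.trans h0)
    have b1 := D.sp_low hs a2.1
    have b2 := D.sp_low hs' a3.1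
    have := D.bt1
    have := D.bt2
    grind
  · have := ((hP _ _ _ rfl hadj).2 hs).bne a2 (by rw [hb]; exact a1) (by rw [hb]; exact a3)
    rw [hb] at this
    exact this a4.symm

section phi
variable {c : Sym2 V → Fin (k + 5)} (φ : G ≃g G)

theorem phi_r (hP : ∀ e, D.P e c) (hφ : ∀ u v : V, G.Adj u v → c s(φ u, φ v) = c s(u, v)) :
    φ D.r = D.r := by
  have h1 := D.zero_sp hP (φ.map_rel_iff.2 D.adj1)
    ((hφ _ _ D.adj1).trans (D.sp_zero hP D.adj1 (Or.inl rfl)))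
  have h2 := D.zero_sp hP (φ.map_rel_iff.2 D.adj2)
    ((hφ _ _ D.adj2).trans (D.sp_zero hP D.adj2 (Or.inr rfl)))
  have hne : φ D.t1 ≠ φ D.t2 := fun h => D.t_ne (φ.injective h)
  unfold sp at h1 h2
  simp only [Sym2.eq_iff] at h1 h2
  have := D.t_ne
  grind

theorem hor_phi (hl : ∀ x, D.lev (φ x) = D.lev x) {x y : V} : φ y ∈ D.hor (φ x) ↔ y ∈ D.hor x := by
  rw [D.mem_hor, D.mem_hor, hl, hl, φ.map_adj_iff]

theorem dn_phi (hl : ∀ x, D.lev (φ x) = D.lev x) {x y : V} : φ y ∈ D.dn (φ x) ↔ y ∈ D.dn x := by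
  rw [D.mem_dn, D.mem_dn, hl, hl, φ.map_adj_iff]

theorem up_phi (hl : ∀ x, D.lev (φ x) = D.lev x) {x y : V} : φ y ∈ D.up (φ x) ↔ y ∈ D.up x := by
  rw [D.mem_up, D.mem_up, hl, hl, φ.map_adj_iff]

theorem hsum_phi (hl : ∀ x, D.lev (φ x) = D.lev x) (hφ : ∀ u v : V, G.Adj u v → c s(φ u, φ v) = c s(u, v)) (x : V) :
    D.hsum c (φ x) = D.hsum c x := by
  unfold hsum
  symm
  apply Finset.sum_equiv φ.toEquiv
  · intro y; exact (D.hor_phi φ hl).symm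
  · intro y hy; rw [← hφ _ _ (D.mem_hor.1 hy).1]; rfl

theorem dsum_phi (hl : ∀ x, D.lev (φ x) = D.lev x) (hφ : ∀ u v : V, G.Adj u v → c s(φ u, φ v) = c s(u, v)) (x : V) :
    D.dsum c (φ x) = D.dsum c x := by
  unfold dsum
  symm
  apply Finset.sum_equiv φ.toEquiv
  · intro y; exact (D.dn_phi φ hl).symm
  · intro y hy; rw [← hφ _ _ (D.mem_dn.1 hy).1]; rfl

theorem up_fix (hl : ∀ x, D.lev (φ x) = D.lev x) {j : ℕ} (hj : ∀ x, D.lev x < j → φ x = x) {x : V} (hx : D.lev x ≤ j) :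
    D.up (φ x) = D.up x := by
  ext u
  constructor
  · intro h
    have h2 := D.mem_up.1 h
    rw [hl] at h2
    rw [← hj u (by omega)] at h
    exact (D.up_phi φ hl).1 h
  · intro h
    have h2 := D.mem_up.1 h
    rw [← hj u (by omega)]
    exact (D.up_phi φ hl).2 h

theorem rival_fix (hl : ∀ x, D.lev (φ x) = D.lev x) (hφ : ∀ u v : V, G.Adj u v → c s(φ u, φ v) = c s(u, v))
    {j : ℕ} (hj : ∀ x, D.lev x < j → φ x = x) {x : V} (hx : D.lev x = j) (h0 : j ≠ 0)
    (hne : φ x ≠ x) : D.rival c x (φ x) := by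
  have hu := D.up_fix φ hl hj hx.le
  have h1 := D.p_key (D.up_ne x (by omega))
  have h2 := D.p_key (D.up_ne (φ x) (by rw [hl]; omega))
  have hp : D.p (φ x) = D.p x := D.p_congr _ _ hu
  rw [hp] at h2
  refine ⟨hne, h1, h2, ?_⟩
  have h3 := D.mem_dn.1 h1.1
  have := hφ _ _ h3.1
  rwa [hj (D.p x) (by omega)] at this

theorem reach_phi (hl : ∀ x, D.lev (φ x) = D.lev x) {x y : V} (h : (Hor G D.lev).Reachable x y) :
    (Hor G D.lev).Reachable (φ x) (φ y) := by
  let f : Hor G D.lev →g Hor G D.lev :=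
    ⟨φ, fun {a b} hab => ⟨φ.map_adj_iff.2 hab.1, by rw [hl, hl]; exact hab.2⟩⟩
  exact h.map f

theorem snk_snk (x : V) : D.snk (D.snk x) = D.snk x := (D.snk_congr _ _ (D.snk_reach x)).symm

theorem fix_step (hl : ∀ x, D.lev (φ x) = D.lev x) (hP : ∀ e, D.P e c) (hδ : ∀ v, 2 ≤ G.degree v)
    (hφ : ∀ u v : V, G.Adj u v → c s(φ u, φ v) = c s(u, v))
    {j : ℕ} (hj : ∀ x, D.lev x < j → φ x = x) {x : V} (hx : D.lev x = j) (h0 : j ≠ 0) :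
    φ x = x := by
  by_contra hne
  have hr := D.rival_fix φ hl hφ hj hx h0 hne
  have hu := D.up_fix φ hl hj hx.le
  by_cases hA : 2 ≤ (D.up x).card
  · refine D.A_contra hP hr hu hA ?_
    have h1 := D.mem_up.1 (D.s_mem x hA)
    have := hφ _ _ h1.1
    rwa [hj (D.s x) (by omega)] at this
  have h1 : (D.up x).card ≤ 1 := by omega
  by_cases hh : (D.hor x).Nonempty
  swap
  · have hdn : (D.dn x).Nonempty := by
      by_contra hd
      have : G.neighborFinset x ⊆ D.up x := by
        intro z hz
        rw [mem_neighborFinset] at hz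
        rcases D.adj_cases hz with h | h | h
        · exact h
        · exact absurd ⟨z, h⟩ hh
        · exact absurd ⟨z, h⟩ hd
      have := Finset.card_le_card this
      rw [card_neighborFinset_eq_degree] at this
      have := hδ x
      omega
    obtain ⟨z, hz⟩ := hdn
    exact D.dn_contra hP hr (D.dsum_phi φ hl hφ x) ⟨z, hz⟩ ⟨φ z, (D.dn_phi φ hl).2 hz⟩
  obtain ⟨z, hz⟩ := hh
  have hzj : D.lev z = j := by rw [← (D.mem_hor.1 hz).2, hx]
  have hz' := (D.hor_phi φ hl).2 hz
  have hsz := D.snk_hor hz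
  have hsz' := D.snk_hor hz'
  have hxz : x ≠ z := (D.mem_hor.1 hz).1.ne
  have hxz' : φ x ≠ φ z := (D.mem_hor.1 hz').1.ne
  rcases lt_trichotomy (D.idx (D.snk (φ x))) (D.idx (D.snk x)) with h | h | h
  · have hmain : ∀ y, D.lev y = j → D.snk y = D.snk x → D.snk (φ y) = D.snk (φ x) →
        y ≠ D.snk y → False := by
      intro y h2 h3 h4 h5
      have hny : φ y ≠ y := by
        intro h6
        rw [h6, h3] at h4
        rw [h4] at h
        exact lt_irrefl _ h
      exact D.hor_contra2 hP (D.rival_fix φ hl hφ hj h2 h0 hny) (D.hsum_phi φ hl hφ y) h5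
        (by rw [h3, h4]; exact h)
    by_cases h6 : x = D.snk x
    · exact hmain z hzj hsz hsz' (by rw [hsz, ← h6]; exact hxz.symm)
    · exact hmain x hx rfl rfl h6
  · have h := D.idx_inj h
    by_cases h6 : D.snk x = φ x
    · exact D.snk_contra hP hr hu h1 h6
    by_cases h7 : D.snk (φ x) = x
    · exact D.snk_contra hP (D.rival_symm hr) hu.symm (by rw [hu]; exact h1) h7
    exact D.hor_contra hP hr (D.hsum_phi φ hl hφ x) (by rw [← h]; exact Ne.symm h7)
      (by rw [h]; exact Ne.symm h6)
  · have hmain : ∀ y, D.lev y = j → D.snk y = D.snk x → D.snk (φ y) = D.snk (φ x) →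
        φ y ≠ D.snk (φ y) → False := by
      intro y h2 h3 h4 h5
      have hny : φ y ≠ y := by
        intro h6
        rw [h6, h3] at h4
        rw [h4] at h
        exact lt_irrefl _ h
      exact D.hor_contra2 hP (D.rival_symm (D.rival_fix φ hl hφ hj h2 h0 hny))
        (D.hsum_phi φ hl hφ y).symm h5 (by rw [h3, h4]; exact h)
    by_cases h6 : φ x = D.snk (φ x)
    · exact hmain z hzj hsz hsz' (by rw [hsz', ← h6]; exact hxz'.symm)
    · exact hmain x hx rfl rfl h6

theorem distinguishing (hl : ∀ x, D.lev (φ x) = D.lev x) (hP : ∀ e, D.P e c)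
    (hδ : ∀ v, 2 ≤ G.degree v)
    (hφ : ∀ u v : V, G.Adj u v → c s(φ u, φ v) = c s(u, v)) (x : V) : φ x = x := by
  have key : ∀ j x, D.lev x = j → φ x = x := by
    intro j
    induction j using Nat.strong_induction_on with
    | _ j ih =>
      intro x hx
      by_cases h0 : j = 0
      · rw [D.lev_zero x (by omega)]; exact D.phi_r φ hP hφ
      · exact D.fix_step φ hl hP hδ hφ (fun y hy => ih _ hy y rfl) hx h0
  exact key _ x rfl

end phi
end Dat
end MDI

namespace MDI
variable {V : Type*} [Fintype V] [DecidableEq V] {G : SimpleGraph V} [DecidableRel G.Adj]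

theorem exists_closer {W : Type*} {H : SimpleGraph W} {x y : W} (h : H.Reachable x y) (hne : x ≠ y) :
    ∃ z, H.Adj x z ∧ H.dist z y < H.dist x y := by
  obtain ⟨w, hw⟩ := h.exists_walk_length_eq_dist
  cases w with
  | nil => exact absurd rfl hne
  | cons ha w =>
    refine ⟨_, ha, ?_⟩
    rw [← hw, Walk.length_cons]
    have := dist_le w
    omega

theorem exists_dat (hconn : G.Connected) (r : V) (hr : 4 ≤ G.degree r) :
    ∃ D : Dat G, D.r = r ∧ D.lev = fun x => G.dist x r := by
  classical
  set lev : V → ℕ := fun x => G.dist x r with hlev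
  let idx : V → ℕ := fun x => (Fintype.equivFin V x : Fin _)
  have idx_inj : Function.Injective idx := by
    intro x y h
    exact (Fintype.equivFin V).injective (Fin.ext h)
  have hpm : ∀ S : Finset V, ∃ m, S.Nonempty → m ∈ S ∧ ∀ u ∈ S, idx m ≤ idx u := by
    intro S
    by_cases h : S.Nonempty
    · obtain ⟨m, hm, h2⟩ := S.exists_min_image idx h
      exact ⟨m, fun _ => ⟨hm, h2⟩⟩
    · exact ⟨r, fun h2 => absurd h2 h⟩
  choose pm hpm using hpm
  let up : V → Finset V := upS G lev
  have mem_up : ∀ x u, u ∈ up x ↔ G.Adj u x ∧ lev u < lev x := by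
    intro x u; simp [up, upS]
  let dn : V → Finset V := dnS G lev
  have mem_dn : ∀ x u, u ∈ dn x ↔ G.Adj x u ∧ lev x < lev u := by
    intro x u; simp [dn, dnS]
  let H := Hor G lev
  have hsk : ∀ C : H.ConnectedComponent, ∃ z, H.connectedComponentMk z = C ∧
      ∀ y, H.connectedComponentMk y = C → 2 ≤ (up y).card → 2 ≤ (up z).card := by
    intro C
    by_cases h : ∃ y, H.connectedComponentMk y = C ∧ 2 ≤ (up y).card
    · obtain ⟨y, h1, h2⟩ := h
      exact ⟨y, h1, fun _ _ _ => h2⟩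
    · obtain ⟨z, hz⟩ := C.exists_rep
      exact ⟨z, hz, fun y h1 h2 => absurd ⟨y, h1, h2⟩ h⟩
  choose sk hsk1 hsk2 using hsk
  let snk : V → V := fun x => sk (H.connectedComponentMk x)
  have snk_congr : ∀ x y, H.Reachable x y → snk x = snk y := by
    intro x y h
    simp only [snk]
    rw [ConnectedComponent.eq.2 h]
  have snk_reach : ∀ x, H.Reachable x (snk x) := by
    intro x
    exact (ConnectedComponent.eq.1 (hsk1 (H.connectedComponentMk x))).symm
  have snk_snk : ∀ x, snk (snk x) = snk x := fun x => (snk_congr _ _ (snk_reach x)).symm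
  have hrep : ∀ S : Finset V, ∃ z, (∃ y, up y = S) → up z = S := by
    intro S
    by_cases h : ∃ y, up y = S
    · obtain ⟨y, hy⟩ := h; exact ⟨y, fun _ => hy⟩
    · exact ⟨r, fun h2 => absurd h2 h⟩
  choose rep hrep using hrep
  let b : V → V := fun y => if 2 ≤ (up y).card then rep (up y) else
    if (up (snk y)).card ≤ 1 then snk y else y
  have b_hi : ∀ y, 2 ≤ (up y).card → b y = rep (up y) := fun y h => if_pos h
  have b_up : ∀ y, 2 ≤ (up y).card → up (b y) = up y := by
    intro y h; rw [b_hi y h]; exact hrep _ ⟨y, rfl⟩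
  have b_low : ∀ y, (up y).card ≤ 1 → (up (snk y)).card ≤ 1 → b y = snk y := by
    intro y h h2
    simp only [b]
    rw [if_neg (by omega), if_pos h2]
  have b_low2 : ∀ y, (up y).card ≤ 1 → ¬ (up (snk y)).card ≤ 1 → b y = y := by
    intro y h h2
    simp only [b]
    rw [if_neg (by omega), if_neg h2]
  have b_b : ∀ y, b (b y) = b y := by
    intro y
    by_cases h : 2 ≤ (up y).card
    · rw [b_hi (b y) (by rw [b_up y h]; exact h), b_up y h, b_hi y h]
    · by_cases h2 : (up (snk y)).card ≤ 1
      · rw [b_low y (by omega) h2, b_low _ h2 (by rw [snk_snk]; exact h2), snk_snk]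
      · rw [b_low2 y (by omega) h2, b_low2 y (by omega) h2]
  let p : V → V := fun x => pm (up x)
  let s : V → V := fun x => pm ((up x).erase (p x))
  have p_mem : ∀ x, (up x).Nonempty → p x ∈ up x := fun x h => (hpm _ h).1
  have s_mem' : ∀ x, 2 ≤ (up x).card → s x ∈ (up x).erase (p x) := by
    intro x h
    refine (hpm _ ?_).1
    rw [← Finset.card_pos, Finset.card_erase_of_mem (p_mem x (by rw [← Finset.card_pos]; omega))]
    omega
  have hfin : ∀ u, ∃ f, (dn u).Nonempty → f ∈ dn u ∧ ((p f = u ∧ b f ≠ f) ∨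
      (b f = f ∧ ∀ y ∈ dn u, p y = u → b y = y)) := by
    intro u
    by_cases hne : (dn u).Nonempty
    swap
    · exact ⟨r, fun h => absurd h hne⟩
    by_cases h : ∃ y ∈ dn u, p y = u ∧ b y ≠ y
    · obtain ⟨y, h1, h2, h3⟩ := h
      exact ⟨y, fun _ => ⟨h1, Or.inl ⟨h2, h3⟩⟩⟩
    · push Not at h
      obtain ⟨y, hy⟩ := hne
      have hyu : u ∈ up y := (mem_up _ _).2 ((mem_dn _ _).1 hy)
      refine ⟨b y, fun _ => ⟨?_, Or.inr ⟨b_b y, h⟩⟩⟩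
      by_cases hp : p y = u
      · rw [h y hy hp]; exact hy
      · have h2 : 2 ≤ (up y).card := by
          have h3 := p_mem y ⟨u, hyu⟩
          exact Finset.one_lt_card.2 ⟨_, h3, _, hyu, hp⟩
        rw [← b_up y h2] at hyu
        exact (mem_dn _ _).2 ((mem_up _ _).1 hyu)
  choose fin hfin using hfin
  have htt : ∃ t1 t2, t1 ≠ t2 ∧ G.Adj r t1 ∧ G.Adj r t2 ∧ b t1 ≠ t2 ∧ b t2 ≠ t1 := by
    rw [← card_neighborFinset_eq_degree] at hr
    by_cases h : ∃ y, G.Adj r y ∧ b y ≠ y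
    · obtain ⟨y, hy, hby⟩ := h
      have : ∃ z ∈ G.neighborFinset r, z ∉ ({y, b y} : Finset V) := by
        apply Finset.exists_mem_notMem_of_card_lt_card
        have := Finset.card_le_two (a := y) (b := b y)
        omega
      obtain ⟨z, hz, hz2⟩ := this
      simp only [Finset.mem_insert, Finset.mem_singleton, not_or] at hz2
      rw [mem_neighborFinset] at hz
      refine ⟨y, z, Ne.symm hz2.1, hy, hz, Ne.symm hz2.2, ?_⟩
      intro h
      rw [← h] at hby
      exact hby (b_b z)
    · push Not at h
      obtain ⟨t1, h1, t2, h2, hne⟩ := Finset.one_lt_card.1 (show 1 < (G.neighborFinset r).card by omega)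
      rw [mem_neighborFinset] at h1 h2
      exact ⟨t1, t2, hne, h1, h2, by rw [h t1 h1]; exact hne, by rw [h t2 h2]; exact hne.symm⟩
  obtain ⟨t1, t2, t_ne, adj1, adj2, bt1, bt2⟩ := htt
  refine ⟨{ lev := lev, idx := idx, p := p, s := s, b := b, fin := fin, snk := snk,
            d := fun x => H.dist x (snk x), r := r, t1 := t1, t2 := t2
            lev_adj := ?_, idx_inj := idx_inj, p_mem := p_mem, p_min := ?_, p_congr := ?_
            s_mem := fun x h => Finset.mem_of_mem_erase (s_mem' x h)
            s_ne := fun x h => Finset.ne_of_mem_erase (s_mem' x h)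
            s_min := ?_, s_congr := ?_, b_b := b_b, b_up := b_up, b_congr := ?_, b_low := b_low
            fin_mem := fun u h => (hfin u h).1, fin_spec := fun u h => (hfin u h).2
            snk_reach := snk_reach, snk_congr := snk_congr, snk_A := ?_, d_near := ?_, d_snk := ?_
            lev_r := ?_, lev_zero := ?_, up_ne := ?_, t_ne := t_ne, adj1 := adj1, adj2 := adj2
            bt1 := bt1, bt2 := bt2 }, rfl, rfl⟩
  · intro x y h
    have := hconn.dist_triangle (u := y) (v := x) (w := r)
    rw [SimpleGraph.dist_eq_one_iff_adj.2 h.symm] at this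
    simp only [hlev]; omega
  · intro x u hu; exact (hpm _ ⟨u, hu⟩).2 u hu
  · intro x y h; change pm (up x) = pm (up y); rw [show up x = up y from h]
  · intro x u hu hne
    have : u ∈ (up x).erase (p x) := Finset.mem_erase.2 ⟨hne, hu⟩
    exact (hpm _ ⟨u, this⟩).2 u this
  · intro x y h
    change pm ((up x).erase (pm (up x))) = pm ((up y).erase (pm (up y)))
    rw [show up x = up y from h]
  · intro x y h1 h2
    have h2 : up x = up y := h2
    rw [b_hi x h1, b_hi y (by rw [← h2]; exact h1), h2]
  · intro x y h1 h2
    exact hsk2 _ y (ConnectedComponent.eq.2 h1.symm) h2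
  · intro x hx
    obtain ⟨z, h1, h2⟩ := exists_closer (snk_reach x) hx
    refine ⟨z, h1, ?_⟩
    rw [← snk_congr x z h1.reachable]
    exact h2
  · intro x
    rw [snk_snk]; simp
  · simp [hlev]
  · intro x hx
    exact (hconn x r).dist_eq_zero_iff.1 hx
  · intro x hx
    obtain ⟨z, h1, h2⟩ := exists_closer (hconn x r) (by rintro rfl; simp [hlev] at hx)
    exact ⟨z, (mem_up _ _).2 ⟨h1.symm, h2⟩⟩

theorem dist_phi {W : Type*} {G : SimpleGraph W} (hconn : G.Connected) (φ : G ≃g G) (x y : W) :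
    G.dist (φ x) (φ y) = G.dist x y := by
  have key : ∀ (ψ : G ≃g G) x y, G.dist (ψ x) (ψ y) ≤ G.dist x y := by
    intro ψ x y
    obtain ⟨w, hw⟩ := (hconn x y).exists_walk_length_eq_dist
    rw [← hw, ← Walk.length_map ψ.toHom w]
    exact dist_le _
  apply le_antisymm (key φ x y)
  simpa using key φ.symm (φ x) (φ y)

theorem big_case (hconn : G.Connected) (hδ : ∀ v, 2 ≤ G.degree v) (r : V) (hr : 4 ≤ G.degree r)
    {k : ℕ} (hk : 2 ≤ k) (hΔ : ∀ v, G.degree v ≤ k * k) :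
    ∃ c : Sym2 V → Fin (k + 5),
      (∀ u α, 2 * ((G.neighborFinset u).filter (fun v => c s(u, v) = α)).card ≤ G.degree u) ∧
      ∀ φ : G ≃g G, (∀ u v : V, G.Adj u v → c s(φ u, φ v) = c s(u, v)) → ∀ x : V, φ x = x := by
  obtain ⟨D, hDr, hDl⟩ := exists_dat hconn r hr
  obtain ⟨c, hc⟩ := D.exists_col hk hδ hΔ
  refine ⟨c, D.majority hc hδ (by rw [hDr]; exact hr), ?_⟩
  intro φ hφ
  have h1 := D.phi_r φ hc hφ
  refine D.distinguishing φ ?_ hc hδ hφ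
  intro x
  rw [hDr] at h1
  rw [hDl]
  dsimp only
  rw [← dist_phi hconn φ x r, h1]

end MDI

namespace MDI
variable {V : Type*} [Fintype V] [DecidableEq V] {G : SimpleGraph V} [DecidableRel G.Adj]

theorem small_case (hconn : G.Connected) (hδ : ∀ v, 2 ≤ G.degree v) (r : V)
    {k : ℕ} (hk : 2 ≤ k) (hΔ : ∀ v, G.degree v ≤ 3) :
    ∃ c : Sym2 V → Fin (k + 5),
      (∀ u α, 2 * ((G.neighborFinset u).filter (fun v => c s(u, v) = α)).card ≤ G.degree u) ∧
      ∀ φ : G ≃g G, (∀ u v : V, G.Adj u v → c s(φ u, φ v) = c s(u, v)) → ∀ x : V, φ x = x := by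
  classical
  have hdr := hδ r
  rw [← card_neighborFinset_eq_degree] at hdr
  obtain ⟨s, hs, t, ht, hst⟩ := Finset.one_lt_card.1 (show 1 < (G.neighborFinset r).card by omega)
  rw [mem_neighborFinset] at hs ht
  have h01 : (0 : Fin (k + 5)) ≠ 1 := by
    intro h; have := congrArg Fin.val h; simp at this
  have he12 : s(r, s) ≠ s(r, t) := by
    intro h; rw [Sym2.congr_right] at h; exact hst h
  let rank : Sym2 V → ℕ := fun e => (Fintype.equivFin (Sym2 V) e : Fin _)
  have rank_inj : Function.Injective rank := by
    intro x y h
    exact (Fintype.equivFin (Sym2 V)).injective (Fin.ext h)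
  let P : Sym2 V → (Sym2 V → Fin (k + 5)) → Prop := fun e c =>
    (e = s(r, s) → c e = 0) ∧ (e = s(r, t) → c e = 1) ∧
    (e ≠ s(r, s) → e ≠ s(r, t) → c e ≠ 0 ∧ c e ≠ 1 ∧
      ∀ x y z, e = s(x, y) → G.Adj x y → G.Adj x z → rank s(x, z) < rank e → c e ≠ c s(x, z))
  obtain ⟨c, hc⟩ : ∃ c, ∀ e, P e c := by
    apply greedy rank rank_inj
    · rintro e c c' h ⟨h1, h2, h3⟩
      have h0 := h e le_rfl
      refine ⟨fun a => by rw [← h0]; exact h1 a, fun a => by rw [← h0]; exact h2 a, fun a b => ?_⟩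
      obtain ⟨h4, h5, h6⟩ := h3 a b
      refine ⟨by rw [← h0]; exact h4, by rw [← h0]; exact h5, ?_⟩
      intro x y z g1 g2 g3 g4
      rw [← h0, ← h _ g4.le]
      exact h6 x y z g1 g2 g3 g4
    · intro e c _
      by_cases e1 : e = s(r, s)
      · refine ⟨0, ?_⟩
        simp only [P]
        refine ⟨fun _ => by simp, fun h => absurd (e1.symm.trans h) he12, fun h => absurd e1 h⟩
      by_cases e2 : e = s(r, t)
      · refine ⟨1, ?_⟩
        simp only [P]
        refine ⟨fun h => absurd h e1, fun _ => by simp, fun _ h => absurd e2 h⟩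
      induction e using Sym2.ind with
      | _ x y =>
      let F : Finset (Fin (k + 5)) := {0, 1} ∪ (
        (if G.Adj x y then ((G.neighborFinset x).erase y).image (fun z => c s(x, z)) else ∅) ∪
        (if G.Adj x y then ((G.neighborFinset y).erase x).image (fun z => c s(y, z)) else ∅))
      have hb : ∀ x y, (if G.Adj x y then ((G.neighborFinset x).erase y).image
          (fun z => c s(x, z)) else ∅).card ≤ 2 := by
        intro x y
        split_ifs with h
        · refine Finset.card_image_le.trans ?_
          rw [Finset.card_erase_of_mem (by rw [mem_neighborFinset]; exact h),
            card_neighborFinset_eq_degree]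
          have := hΔ x
          omega
        · simp
      have hF : F.card < (Finset.univ : Finset (Fin (k + 5))).card := by
        have g1 := hb x y
        have g2 := hb y x
        simp only [G.adj_comm y x] at g2
        have g3 := Finset.card_le_two (a := (0 : Fin (k + 5))) (b := 1)
        have g4 := Finset.card_union_le ({0, 1} : Finset (Fin (k + 5))) (
          (if G.Adj x y then ((G.neighborFinset x).erase y).image (fun z => c s(x, z)) else ∅) ∪
          (if G.Adj x y then ((G.neighborFinset y).erase x).image (fun z => c s(y, z)) else ∅))
        have g5 := Finset.card_union_le
          (if G.Adj x y then ((G.neighborFinset x).erase y).image (fun z => c s(x, z)) else ∅)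
          (if G.Adj x y then ((G.neighborFinset y).erase x).image (fun z => c s(y, z)) else ∅)
        rw [Finset.card_univ, Fintype.card_fin]
        simp only [F]
        omega
      obtain ⟨α, _, hα⟩ := Finset.exists_mem_notMem_of_card_lt_card hF
      refine ⟨α, ?_⟩
      simp only [F, Finset.mem_union, Finset.mem_insert, Finset.mem_singleton, not_or] at hα
      obtain ⟨⟨a1, a2⟩, a3, a4⟩ := hα
      refine ⟨fun h => absurd h e1, fun h => absurd h e2, fun _ _ => ?_⟩
      rw [Function.update_self]
      refine ⟨a1, a2, ?_⟩
      intro x' y' z h1 h2 h3 h4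
      have hne : s(x', z) ≠ s(x, y) := by
        intro h; rw [h] at h4; exact lt_irrefl _ h4
      rw [Function.update_of_ne hne]
      rw [Sym2.eq_iff] at h1
      rcases h1 with ⟨rfl, rfl⟩ | ⟨rfl, rfl⟩
      · rw [if_pos h2] at a3
        rintro rfl
        apply a3
        refine Finset.mem_image.2 ⟨z, ?_, rfl⟩
        rw [Finset.mem_erase, mem_neighborFinset]
        exact ⟨by rintro rfl; exact hne rfl, h3⟩
      · rw [if_pos h2.symm] at a4
        rintro rfl
        apply a4
        refine Finset.mem_image.2 ⟨z, ?_, rfl⟩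
        rw [Finset.mem_erase, mem_neighborFinset]
        exact ⟨by rintro rfl; exact hne Sym2.eq_swap, h3⟩
  have c0 : ∀ e, c e = 0 → e = s(r, s) := by
    intro e h
    obtain ⟨h1, h2, h3⟩ := hc e
    by_contra hne
    by_cases h4 : e = s(r, t)
    · rw [h2 h4] at h; exact h01 h.symm
    · exact (h3 hne h4).1 h
  have c1 : ∀ e, c e = 1 → e = s(r, t) := by
    intro e h
    obtain ⟨h1, h2, h3⟩ := hc e
    by_contra hne
    by_cases h4 : e = s(r, s)
    · rw [h1 h4] at h; exact h01 h
    · exact (h3 h4 hne).2.1 h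
  have hlt : ∀ x y z, G.Adj x y → G.Adj x z → rank s(x, z) < rank s(x, y) →
      c s(x, y) = c s(x, z) → y = z := by
    intro x y z h1 h2 h3 h
    by_contra hyz
    have hne : s(x, y) ≠ s(x, z) := by
      intro h; rw [Sym2.congr_right] at h; exact hyz h
    obtain ⟨g1, g2, g3⟩ := hc s(x, y)
    by_cases e1 : s(x, y) = s(r, s)
    · have := c0 _ (h.symm.trans (g1 e1)); exact hne (e1.trans this.symm)
    by_cases e2 : s(x, y) = s(r, t)
    · have := c1 _ (h.symm.trans (g2 e2)); exact hne (e2.trans this.symm)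
    exact (g3 e1 e2).2.2 x y z rfl h1 h2 h3 h
  have proper : ∀ x y z, G.Adj x y → G.Adj x z → c s(x, y) = c s(x, z) → y = z := by
    intro x y z h1 h2 h
    rcases lt_trichotomy (rank s(x, y)) (rank s(x, z)) with h3 | h3 | h3
    · exact (hlt x z y h2 h1 h3 h.symm).symm
    · have := rank_inj h3
      rwa [Sym2.congr_right] at this
    · exact hlt x y z h1 h2 h3 h
  refine ⟨c, ?_, ?_⟩
  · intro u α
    have : ((G.neighborFinset u).filter (fun v => c s(u, v) = α)).card ≤ 1 := by
      rw [Finset.card_le_one]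
      intro a ha b hb
      rw [Finset.mem_filter, mem_neighborFinset] at ha hb
      exact proper u a b ha.1 hb.1 (ha.2.trans hb.2.symm)
    have := hδ u
    omega
  · intro φ hφ
    have h1 := c0 _ ((hφ r s hs).trans ((hc _).1 rfl))
    have h2 := c1 _ ((hφ r t ht).trans ((hc _).2.1 rfl))
    have hr : φ r = r := by
      simp only [Sym2.eq_iff] at h1 h2
      grind
    have key : ∀ x y, G.Reachable x y → φ x = x → φ y = y := by
      rintro x y ⟨w⟩
      induction w with
      | nil => exact id
      | cons h w ih =>
        intro hx
        apply ih
        have h3 := hφ _ _ h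
        have h4 := φ.map_adj_iff.2 h
        rw [hx] at h3 h4
        exact proper _ _ _ h4 h h3
    exact fun x => key r x (hconn r x) hr
end MDI


/-- Every finite connected graph `G` with minimum degree at least `2` has a majority
distinguishing edge coloring with `⌈√Δ⌉ + 5` colors, i.e. `M'_D(G) ≤ ⌈√Δ(G)⌉ + 5`. -/
theorem majority_distinguishing_index_le {V : Type*} [Fintype V] [DecidableEq V]
    (G : SimpleGraph V) [DecidableRel G.Adj]
    (hconn : G.Connected) (hδ : ∀ v : V, 2 ≤ G.degree v) :
    ∃ c : Sym2 V → Fin (⌈Real.sqrt (G.maxDegree : ℝ)⌉₊ + 5),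
      IsMajorityEdgeColoring G c ∧ IsDistinguishingEdgeColoring G c := by
  obtain ⟨r, hr⟩ := @SimpleGraph.exists_maximal_degree_vertex _ G _ _ hconn.nonempty
  have hmax : ∀ v, G.degree v ≤ G.maxDegree := fun v => G.degree_le_maxDegree v
  have hsq : G.maxDegree ≤ ⌈Real.sqrt (G.maxDegree : ℝ)⌉₊ * ⌈Real.sqrt (G.maxDegree : ℝ)⌉₊ := by
    have h1 := Nat.le_ceil (Real.sqrt (G.maxDegree : ℝ))
    have h2 := Real.mul_self_sqrt (Nat.cast_nonneg (α := ℝ) G.maxDegree)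
    have h3 := mul_self_le_mul_self (Real.sqrt_nonneg _) h1
    rw [h2] at h3
    exact_mod_cast h3
  have h2 : 2 ≤ G.maxDegree := (hδ r).trans (hmax r)
  have hk : 2 ≤ ⌈Real.sqrt (G.maxDegree : ℝ)⌉₊ := by
    by_contra h
    have : ⌈Real.sqrt (G.maxDegree : ℝ)⌉₊ ≤ 1 := by omega
    have := Nat.mul_le_mul this this
    omega
  by_cases h4 : 4 ≤ G.maxDegree
  · exact MDI.big_case hconn hδ r (by rw [← hr]; exact h4) hk (fun v => (hmax v).trans hsq)
  · exact MDI.small_case hconn hδ r hk (fun v => (hmax v).trans (by omega))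
end

section
/- Let G be a finite 2-connected simple graph with maximum degree Δ. Then M'_D(G) ≤ ⌈√Δ⌉ + 5; that is, G has an edge coloring with ⌈√Δ⌉ + 5 colors that is both a majority edge coloring and a distinguishing edge coloring. -/
open SimpleGraph

/-! ### Part 1: an st-ordering of a 2-connected graph -/

/-- Connectedness of a vertex set, phrased through cuts. -/
def CutConn {V : Type*} [DecidableEq V] (G : SimpleGraph V) (S : Finset V) : Prop :=
  ∀ A ⊆ S, A.Nonempty → (S \ A).Nonempty → ∃ a ∈ A, ∃ b ∈ S \ A, G.Adj a b

lemma cutConn_insert {V : Type*} [DecidableEq V] (G : SimpleGraph V) {C : Finset V}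
    (hC : CutConn G C) {c d : V} (hc : c ∈ C) (hcd : G.Adj c d) : CutConn G (insert d C) := by
  intro A hA hAne hBne
  by_cases hd : d ∈ C
  · rw [Finset.insert_eq_of_mem hd] at *
    exact hC A hA hAne hBne
  by_cases hdA : d ∈ A
  · by_cases hcA : c ∈ A
    · obtain ⟨b, hb⟩ := hBne
      have hbC : b ∈ C := by
        simp only [Finset.mem_sdiff, Finset.mem_insert] at hb
        rcases hb.1 with h | h
        · subst h; exact absurd hdA hb.2
        · exact h
      obtain ⟨a, ha, b', hb', hab⟩ := hC (A.erase d)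
        (by
          intro x hx
          have := hA (Finset.mem_of_mem_erase hx)
          simp only [Finset.mem_insert] at this
          rcases this with h | h
          · exact absurd h (Finset.ne_of_mem_erase hx)
          · exact h)
        ⟨c, Finset.mem_erase.2 ⟨fun h => hd (h ▸ hc), hcA⟩⟩
        ⟨b, by
          simp only [Finset.mem_sdiff] at hb ⊢
          exact ⟨hbC, fun h => hb.2 (Finset.mem_of_mem_erase h)⟩⟩
      refine ⟨a, Finset.mem_of_mem_erase ha, b', ?_, hab⟩
      simp only [Finset.mem_sdiff, Finset.mem_insert, Finset.mem_erase, not_and] at hb' ⊢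
      refine ⟨Or.inr hb'.1, fun h => hb'.2 ?_ h⟩
      rintro rfl
      exact hd hb'.1
    · exact ⟨d, hdA, c, by simp [hc, hcA], hcd.symm⟩
  · by_cases hcA : c ∈ A
    · exact ⟨c, hcA, d, by simp [hdA], hcd⟩
    · have hAC : A ⊆ C := by
        intro x hx
        have := hA hx
        simp only [Finset.mem_insert] at this
        rcases this with h | h
        · subst h; exact absurd hx hdA
        · exact h
      obtain ⟨a, ha, b', hb', hab⟩ := hC A hAC hAne ⟨c, by simp [hc, hcA]⟩
      refine ⟨a, ha, b', ?_, hab⟩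
      simp only [Finset.mem_sdiff, Finset.mem_insert] at hb' ⊢
      exact ⟨Or.inr hb'.1, hb'.2⟩

lemma cutConn_of_induce {V : Type*} [Fintype V] [DecidableEq V] (G : SimpleGraph V) (v : V)
    (h : (G.induce ({v}ᶜ : Set V)).Connected) : CutConn G ({v}ᶜ : Finset V) := by
  intro A hA ⟨a, ha⟩ ⟨b, hb⟩
  by_contra hcon
  push Not at hcon
  have hav : a ∈ ({v}ᶜ : Set V) := by simpa using hA ha
  have hbv : b ∈ ({v}ᶜ : Set V) := by
    simp only [Finset.mem_sdiff] at hb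
    simpa using hb.1
  have key : ∀ x y : ({v}ᶜ : Set V), (G.induce ({v}ᶜ : Set V)).Walk x y → x.1 ∈ A → y.1 ∈ A := by
    intro x y p
    induction p with
    | nil => exact id
    | @cons x y z hxy p ih =>
      intro hx
      apply ih
      by_contra hy
      refine hcon x.1 hx y.1 ?_ (by simpa using hxy)
      simp only [Finset.mem_sdiff, hy, not_false_eq_true, and_true]
      exact Finset.mem_compl.2 (fun h => y.2 (Finset.mem_singleton.1 h))
  obtain ⟨p⟩ := h.preconnected ⟨a, hav⟩ ⟨b, hbv⟩
  have := key _ _ p ha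
  simp only [Finset.mem_sdiff] at hb
  exact hb.2 this

lemma order_step {V : Type*} [Fintype V] [DecidableEq V] (G : SimpleGraph V)
    (h2 : ∀ v : V, CutConn G ({v}ᶜ : Finset V)) (T : V) (F : Finset V) (hF : F.Nonempty)
    (hT : T ∉ F) (hconn : CutConn G Fᶜ) (hne : ∃ u, u ∉ F ∧ u ≠ T) :
    ∃ y, y ∉ F ∧ y ≠ T ∧ (∃ x ∈ F, G.Adj x y) ∧ CutConn G (insert y F)ᶜ := by
  classical
  let Q : Finset (V × Finset V) := Finset.univ.filter (fun q => q.1 ∉ F ∧ q.1 ≠ T ∧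
    (∃ x ∈ F, G.Adj x q.1) ∧ q.2 ⊆ (insert q.1 F)ᶜ ∧ T ∈ q.2 ∧ CutConn G q.2)
  have hQ : Q.Nonempty := by
    obtain ⟨u, hu, huT⟩ := hne
    obtain ⟨a, ha, b, hb, hab⟩ := h2 T F (by
      intro x hx
      simp only [Finset.mem_compl, Finset.mem_singleton]
      rintro rfl
      exact hT hx) hF ⟨u, by simp [hu, huT]⟩
    simp only [Finset.mem_sdiff, Finset.mem_compl, Finset.mem_singleton] at hb
    refine ⟨(b, {T}), ?_⟩
    simp only [Q, Finset.mem_filter, Finset.mem_univ, true_and]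
    refine ⟨hb.2, hb.1, ⟨a, ha, hab⟩, ?_, by simp, ?_⟩
    · intro x hx
      simp only [Finset.mem_singleton] at hx
      subst hx
      simp [hT, Ne.symm hb.1]
    · intro A hA ⟨a, ha⟩ ⟨b, hb⟩
      have h1 := hA ha
      simp only [Finset.mem_sdiff, Finset.mem_singleton] at hb h1
      rw [h1, ← hb.1] at ha
      exact absurd ha hb.2
  obtain ⟨⟨y, C⟩, hyC, hmax⟩ := Finset.exists_max_image Q (fun q => q.2.card) hQ
  simp only [Q, Finset.mem_filter, Finset.mem_univ, true_and] at hyC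
  obtain ⟨hyF, hyT, hyx, hCs, hTC, hCc⟩ := hyC
  refine ⟨y, hyF, hyT, hyx, ?_⟩
  by_cases hCe : C = (insert y F)ᶜ
  · rw [← hCe]; exact hCc
  exfalso
  have hyC : y ∉ C := fun h => by simpa using hCs h
  have hCF : ∀ x ∈ C, x ∉ F := fun x hx h => by
    have := hCs hx
    simp [h] at this
  have hnoedge : ∀ c ∈ C, ∀ d, d ∉ C → d ∉ F → d ≠ y → ¬ G.Adj c d := by
    intro c hc d hdC hdF hdy hcd
    have := hmax (y, insert d C) (by
      simp only [Q, Finset.mem_filter, Finset.mem_univ, true_and]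
      refine ⟨hyF, hyT, hyx, ?_, by simp [hTC], cutConn_insert G hCc hc hcd⟩
      intro x hx
      rcases Finset.mem_insert.1 hx with h | h
      · subst h; simp [hdF, hdy]
      · exact hCs h)
    simp only [Finset.card_insert_of_notMem hdC] at this
    omega
  have hDne : ((insert y F)ᶜ \ C).Nonempty := by
    rw [Finset.sdiff_nonempty]
    intro h
    exact hCe (Finset.Subset.antisymm hCs h)
  obtain ⟨x0, hx0, _⟩ := hyx
  obtain ⟨a, ha, b, hb, hab⟩ := h2 y ((insert y F)ᶜ \ C) (by
    intro x hx
    simp only [Finset.mem_sdiff, Finset.mem_compl, Finset.mem_insert, not_or] at hx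
    simp [hx.1.1]) hDne ⟨x0, by
      simp only [Finset.mem_sdiff, Finset.mem_compl, Finset.mem_insert, Finset.mem_singleton]
      refine ⟨?_, fun h => h.1 (Or.inr hx0)⟩
      rintro rfl
      exact hyF hx0⟩
  simp only [Finset.mem_sdiff, Finset.mem_compl, Finset.mem_insert, Finset.mem_singleton,
    not_or, not_and, not_not] at ha hb
  have hbF : b ∈ F := by
    by_contra hbF
    exact hnoedge b (hb.2 ⟨hb.1, hbF⟩) a ha.2 ha.1.2 ha.1.1 hab.symm
  obtain ⟨c, hc, d, hd, hcd⟩ := hconn C (fun x hx => by simp [hCF x hx]) ⟨T, hTC⟩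
    ⟨y, by simp [hyF, hyC]⟩
  simp only [Finset.mem_sdiff, Finset.mem_compl] at hd
  have hdy : d = y := by
    by_contra hdy
    exact hnoedge c hc d hd.2 hd.1 hdy hcd
  subst hdy
  have := hmax (a, insert d C) (by
    simp only [Q, Finset.mem_filter, Finset.mem_univ, true_and]
    refine ⟨ha.1.2, ?_, ⟨b, hbF, hab.symm⟩, ?_, by simp [hTC], cutConn_insert G hCc hc hcd⟩
    · rintro rfl; exact ha.2 hTC
    · intro x hx
      rcases Finset.mem_insert.1 hx with h | h
      · subst h; simp [hyF, Ne.symm ha.1.1]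
      · have hxa : x ≠ a := by rintro rfl; exact ha.2 h
        simp [hxa, hCF x h])
  simp only [Finset.card_insert_of_notMem hyC] at this
  omega

lemma order_aux {V : Type*} [Fintype V] [DecidableEq V] (G : SimpleGraph V)
    (h2 : ∀ v : V, CutConn G ({v}ᶜ : Finset V)) (T : V) (hTn : ∃ z, G.Adj z T) (m : ℕ) :
    ∀ F : Finset V, F.Nonempty → T ∉ F → CutConn G Fᶜ → F.card + m + 1 = Fintype.card V →
    ∃ r : V → ℕ, Set.InjOn r {v | v ∉ F} ∧ (∀ v ∉ F, F.card ≤ r v ∧ r v < Fintype.card V) ∧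
      r T + 1 = Fintype.card V ∧ (∀ v ∉ F, ∃ u, G.Adj u v ∧ (u ∈ F ∨ u ∉ F ∧ r u < r v)) ∧
      (∀ v ∉ F, v ≠ T → ∃ u ∉ F, G.Adj u v ∧ r v < r u) := by
  induction m with
  | zero =>
    intro F hF hT hc hcard
    have hFc : Fᶜ = {T} := by
      symm
      apply Finset.eq_of_subset_of_card_le
      · simpa using hT
      · rw [Finset.card_compl]; simp; omega
    have hall : ∀ v ∉ F, v = T := fun v hv => by
      have : v ∈ Fᶜ := by simpa using hv
      rw [hFc] at this
      simpa using this
    refine ⟨fun _ => F.card, ?_, ?_, ?_, ?_, ?_⟩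
    · intro a ha b hb _
      rw [hall a ha, hall b hb]
    · intro v _; simp only; omega
    · simp only; omega
    · intro v hv
      rw [hall v hv]
      obtain ⟨z, hz⟩ := hTn
      refine ⟨z, hz, Or.inl ?_⟩
      by_contra hzF
      rw [hall z hzF] at hz
      exact G.loopless.irrefl _ hz
    · intro v hv hvT
      exact absurd (hall v hv) hvT
  | succ m ih =>
    intro F hF hT hc hcard
    have hne : ∃ u, u ∉ F ∧ u ≠ T := by
      by_contra hcon
      push Not at hcon
      have : Fᶜ ⊆ {T} := fun x hx => by simpa using hcon x (by simpa using hx)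
      have := Finset.card_le_card this
      rw [Finset.card_compl] at this
      simp at this
      omega
    obtain ⟨y, hyF, hyT, ⟨x, hx, hxy⟩, hyc⟩ := order_step G h2 T F hF hT hc hne
    obtain ⟨r, h1, h3, h4, h5, h6⟩ := ih (insert y F) (by simp) (by simp [hT, Ne.symm hyT]) hyc
      (by rw [Finset.card_insert_of_notMem hyF]; omega)
    rw [Finset.card_insert_of_notMem hyF] at h3
    have hup : ∀ v, v ≠ y → Function.update r y F.card v = r v := fun v hv => by simp [hv]
    have hni : ∀ v, v ∉ F → v ≠ y → v ∉ insert y F := fun v hv hvy => by simp [hv, hvy]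
    refine ⟨Function.update r y F.card, ?_, ?_, ?_, ?_, ?_⟩
    · intro a ha b hb hab
      by_cases hay : a = y <;> by_cases hby : b = y
      · rw [hay, hby]
      · subst hay
        rw [hup b hby, Function.update_self] at hab
        have := (h3 b (hni b hb hby)).1
        omega
      · subst hby
        rw [hup a hay, Function.update_self] at hab
        have := (h3 a (hni a ha hay)).1
        omega
      · rw [hup a hay, hup b hby] at hab
        exact h1 (hni a ha hay) (hni b hb hby) hab
    · intro v hv
      by_cases hvy : v = y
      · subst hvy; simp; omega
      · rw [hup v hvy]
        have := h3 v (hni v hv hvy)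
        omega
    · rw [hup T (Ne.symm hyT)]; exact h4
    · intro v hv
      by_cases hvy : v = y
      · subst hvy; exact ⟨x, hxy, Or.inl hx⟩
      · obtain ⟨u, huv, hu⟩ := h5 v (hni v hv hvy)
        refine ⟨u, huv, ?_⟩
        by_cases huy : u = y
        · subst huy
          right
          refine ⟨hyF, ?_⟩
          rw [hup v hvy, Function.update_self]
          have := (h3 v (hni v hv hvy)).1
          omega
        · simp only [Finset.mem_insert, huy, false_or] at hu
          rw [hup v hvy, hup u huy]
          exact hu
    · intro v hv hvT
      by_cases hvy : v = y
      · subst hvy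
        obtain ⟨a, ha, b, hb, hab⟩ := hc {v} (by simpa using hv) ⟨v, by simp⟩
          ⟨T, by simp [hT, Ne.symm hyT]⟩
        simp only [Finset.mem_singleton, Finset.mem_sdiff, Finset.mem_compl] at ha hb
        subst ha
        refine ⟨b, hb.1, hab.symm, ?_⟩
        rw [hup b hb.2, Function.update_self]
        have := (h3 b (hni b hb.1 hb.2)).1
        omega
      · obtain ⟨u, hu, huv, hlt⟩ := h6 v (hni v hv hvy) hvT
        simp only [Finset.mem_insert, not_or] at hu
        exact ⟨u, hu.2, huv, by rw [hup v hvy, hup u hu.1]; exact hlt⟩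

/-- An st-ordering: `r` numbers the vertices from `s₁` (number 0) to `T` (the last number). -/
lemma exists_order {V : Type*} [Fintype V] [DecidableEq V] (G : SimpleGraph V)
    (hcard : 3 ≤ Fintype.card V)
    (h2 : ∀ v : V, CutConn G ({v}ᶜ : Finset V)) (v1 T : V) (hadj : G.Adj v1 T) :
    ∃ r : V → ℕ, Function.Injective r ∧ (∀ v, r v < Fintype.card V) ∧
      (∀ t < Fintype.card V, ∃ v, r v = t) ∧ r v1 = 0 ∧ r T + 1 = Fintype.card V ∧
      (∀ v, v ≠ v1 → ∃ u, G.Adj u v ∧ r u < r v) ∧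
      (∀ v, v ≠ T → ∃ u, G.Adj v u ∧ r v < r u) := by
  have hT1 : T ≠ v1 := hadj.ne'
  obtain ⟨r, h1, h3, h4, h5, h6⟩ := order_aux G h2 T ⟨v1, hadj⟩ (Fintype.card V - 2) {v1}
    (by simp) (by simpa using hT1) (h2 v1) (by simp; omega)
  simp only [Finset.mem_singleton, Finset.card_singleton] at h1 h3 h5 h6
  have hup : ∀ v, v ≠ v1 → Function.update r v1 0 v = r v := fun v hv => by simp [hv]
  have hinj : Function.Injective (Function.update r v1 0) := by
    intro a b hab
    by_cases ha : a = v1 <;> by_cases hb : b = v1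
    · rw [ha, hb]
    · subst ha
      rw [hup b hb, Function.update_self] at hab
      have := (h3 b hb).1
      omega
    · subst hb
      rw [hup a ha, Function.update_self] at hab
      have := (h3 a ha).1
      omega
    · rw [hup a ha, hup b hb] at hab
      exact h1 ha hb hab
  have hlt : ∀ v, Function.update r v1 0 v < Fintype.card V := by
    intro v
    by_cases hv : v = v1
    · subst hv; simp; omega
    · rw [hup v hv]; exact (h3 v hv).2
  refine ⟨Function.update r v1 0, hinj, hlt, ?_, by simp, by rw [hup T hT1]; exact h4, ?_, ?_⟩
  · intro t ht
    let f : V → Fin (Fintype.card V) := fun v => ⟨Function.update r v1 0 v, hlt v⟩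
    have hf : Function.Injective f := fun a b hab => hinj (by simpa [f] using hab)
    have hb : Function.Bijective f :=
      (Fintype.bijective_iff_injective_and_card f).2 ⟨hf, by simp⟩
    obtain ⟨v, hv⟩ := hb.2 ⟨t, ht⟩
    exact ⟨v, by simpa [f] using hv⟩
  · intro v hv
    obtain ⟨u, huv, hu⟩ := h5 v hv
    refine ⟨u, huv, ?_⟩
    rw [hup v hv]
    have := (h3 v hv).1
    rcases hu with rfl | ⟨hu, hu'⟩
    · simp; omega
    · rw [hup u hu]; exact hu'
  · intro v hv
    by_cases hv1 : v = v1
    · subst hv1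
      refine ⟨T, hadj, ?_⟩
      rw [hup T hT1, Function.update_self]
      have := (h3 T hT1).1
      omega
    · obtain ⟨u, hu, huv, hlt⟩ := h6 v hv1 hv
      exact ⟨u, huv.symm, by rw [hup v hv1, hup u hu]; exact hlt⟩

/-! ### Part 2: greedy colouring of stars -/

section Greedy
variable {V : Type*} [Fintype V] [DecidableEq V] (G : SimpleGraph V) [DecidableRel G.Adj]

/-- Number of edges at `u` that lie in `D` and have colour `α`. -/
def dcnt {k : ℕ} (D : Finset (Sym2 V)) (c : Sym2 V → Fin k) (u : V) (α : Fin k) : ℕ :=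
  ((G.neighborFinset u).filter (fun w => s(u, w) ∈ D ∧ c s(u, w) = α)).card

/-- The majority condition for the coloured edges `D`. -/
def DMaj {k : ℕ} (D : Finset (Sym2 V)) (c : Sym2 V → Fin k) : Prop :=
  ∀ u α, 2 * dcnt G D c u α ≤ G.degree u

/-- Colours that cannot be used once more at `u`. -/
def dsat {k : ℕ} (D : Finset (Sym2 V)) (c : Sym2 V → Fin k) (u : V) : Finset (Fin k) :=
  Finset.univ.filter (fun α => G.degree u < 2 * (dcnt G D c u α + 1))

lemma dcnt_congr {k : ℕ} {D D' : Finset (Sym2 V)} {c c' : Sym2 V → Fin k} (u : V)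
    (h : ∀ w, G.Adj u w → (s(u, w) ∈ D ↔ s(u, w) ∈ D'))
    (h' : ∀ w, G.Adj u w → s(u, w) ∈ D → c s(u, w) = c' s(u, w)) (α : Fin k) :
    dcnt G D c u α = dcnt G D' c' u α := by
  unfold dcnt
  congr 1
  apply Finset.filter_congr
  intro w hw
  rw [mem_neighborFinset] at hw
  rw [← h w hw]
  constructor
  · rintro ⟨h1, h2⟩; exact ⟨h1, by rw [← h' w hw h1]; exact h2⟩
  · rintro ⟨h1, h2⟩; exact ⟨h1, by rw [h' w hw h1]; exact h2⟩

lemma sum_dcnt {k : ℕ} (D : Finset (Sym2 V)) (c : Sym2 V → Fin k) (u : V) :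
    ∑ α, dcnt G D c u α = ((G.neighborFinset u).filter (fun w => s(u, w) ∈ D)).card := by
  rw [Finset.card_eq_sum_card_fiberwise (f := fun w => c s(u, w)) (t := Finset.univ)
    (fun _ _ => by simp)]
  apply Finset.sum_congr rfl
  intro α _
  rw [Finset.filter_filter]
  rfl

lemma dsat_card_le {k : ℕ} (D : Finset (Sym2 V)) (c : Sym2 V → Fin k) (u w : V)
    (hdeg : 2 ≤ G.degree u) (huw : G.Adj u w) (hD : s(u, w) ∉ D) :
    (dsat G D c u).card ≤ 2 := by
  have h1 : ∑ α ∈ dsat G D c u, dcnt G D c u α ≤ ∑ α, dcnt G D c u α :=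
    Finset.sum_le_univ_sum_of_nonneg (fun _ => Nat.zero_le _)
  rw [sum_dcnt] at h1
  have h2 : ((G.neighborFinset u).filter (fun w => s(u, w) ∈ D)).card < G.degree u := by
    rw [← card_neighborFinset_eq_degree]
    apply Finset.card_lt_card
    refine ⟨Finset.filter_subset _ _, fun h => ?_⟩
    have := h ((mem_neighborFinset G u w).2 huw)
    rw [Finset.mem_filter] at this
    exact hD this.2
  have h3 : (dsat G D c u).card * (G.degree u - 1) ≤ ∑ α ∈ dsat G D c u, 2 * dcnt G D c u α := by
    rw [← smul_eq_mul]
    apply Finset.card_nsmul_le_sum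
    intro α hα
    simp only [dsat, Finset.mem_filter, Finset.mem_univ, true_and] at hα
    omega
  rw [← Finset.mul_sum] at h3
  by_contra hcon
  have h4 : 3 * (G.degree u - 1) ≤ (dsat G D c u).card * (G.degree u - 1) :=
    Nat.mul_le_mul_right _ (by omega)
  omega

lemma dsat_empty {k : ℕ} (D : Finset (Sym2 V)) (c : Sym2 V → Fin k) (u : V)
    (hdeg : 2 ≤ G.degree u) (hD : ∀ w, s(u, w) ∉ D) : dsat G D c u = ∅ := by
  unfold dsat
  rw [Finset.filter_eq_empty_iff]
  intro α _
  have : dcnt G D c u α = 0 := by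
    unfold dcnt
    rw [Finset.card_eq_zero, Finset.filter_eq_empty_iff]
    intro w _ h
    exact hD w h.1
  omega

lemma dcnt_insert {k : ℕ} (D : Finset (Sym2 V)) (c : Sym2 V → Fin k) (v w : V)
    (hvw : G.Adj v w) (hD : s(v, w) ∉ D) (α : Fin k) (β : Fin k) :
    dcnt G (insert s(v, w) D) (Function.update c s(v, w) α) v β
      = dcnt G D c v β + if β = α then 1 else 0 := by
  unfold dcnt
  have key : ((G.neighborFinset v).filter (fun x => s(v, x) ∈ insert s(v, w) D ∧
      Function.update c s(v, w) α s(v, x) = β)) =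
      if β = α then insert w ((G.neighborFinset v).filter (fun x => s(v, x) ∈ D ∧ c s(v, x) = β))
      else ((G.neighborFinset v).filter (fun x => s(v, x) ∈ D ∧ c s(v, x) = β)) := by
    ext x
    by_cases hx : x = w
    · subst hx
      by_cases hβ : β = α
      · simp [hβ, hvw]
      · simp [hβ, hD, Ne.symm hβ]
    · have hne : s(v, x) ≠ s(v, w) := by
        intro h
        exact hx (Sym2.congr_right.1 h)
      by_cases hβ : β = α
      · simp [hβ, hx, hne, hvw.ne]
      · simp [hβ, hx, hne, hvw.ne]
  rw [key]
  split_ifs with h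
  · rw [Finset.card_insert_of_notMem]
    simp [hD]
  · rfl

lemma dmaj_insert {k : ℕ} (D : Finset (Sym2 V)) (c : Sym2 V → Fin k) (v w : V)
    (hvw : G.Adj v w) (hD : s(v, w) ∉ D) (α : Fin k) (hmaj : DMaj G D c)
    (hv : α ∉ dsat G D c v) (hw : α ∉ dsat G D c w) :
    DMaj G (insert s(v, w) D) (Function.update c s(v, w) α) := by
  intro u β
  simp only [dsat, Finset.mem_filter, Finset.mem_univ, true_and, not_lt] at hv hw
  by_cases huv : u = v
  · subst huv
    rw [dcnt_insert G D c u w hvw hD]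
    have := hmaj u β
    split_ifs with h
    · subst h; exact hv
    · simpa using this
  by_cases huw : u = w
  · subst huw
    rw [Sym2.eq_swap, dcnt_insert G D c u v hvw.symm (by rwa [Sym2.eq_swap])]
    have := hmaj u β
    split_ifs with h
    · subst h; exact hw
    · simpa using this
  · rw [← dcnt_congr G (D := D) (c := c) u]
    · exact hmaj u β
    · intro x _
      rw [Finset.mem_insert]
      constructor
      · exact Or.inr
      · rintro (h | h)
        · rw [Sym2.eq_iff] at h
          rcases h with h | h
          · exact absurd h.1 huv
          · exact absurd h.1 huw
        · exact h
    · intro x _ hx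
      rw [Function.update_of_ne]
      rintro h
      exact hD (h ▸ hx)

lemma exists_color {s : ℕ} (B : Finset (Fin (s + 5))) (h : B.card ≤ s + 4) :
    ∃ α, α ∉ B := by
  by_contra hcon
  push Not at hcon
  have : B = Finset.univ := Finset.eq_univ_of_forall hcon
  rw [this] at h
  simp at h

lemma color_star1 {s : ℕ} (hs : 2 ≤ s) (hdeg : ∀ u, 2 ≤ G.degree u) (D : Finset (Sym2 V))
    (c : Sym2 V → Fin (s + 5)) (v : V) (hmaj : DMaj G D c) (R : Finset (Fin (s + 5)))
    (hR : R.card ≤ 2) (W : Finset V) :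
    (∀ w ∈ W, G.Adj v w ∧ s(v, w) ∉ D) → W.card < s ^ 2 →
    ∃ c' : Sym2 V → Fin (s + 5),
      (∀ e, e ∉ W.image (fun w => s(v, w)) → c' e = c e) ∧
      DMaj G (D ∪ W.image (fun w => s(v, w))) c' ∧
      (∀ w ∈ W, c' s(v, w) ∉ R) ∧
      ∀ α, (W.filter (fun w => (∀ z, s(w, z) ∉ D) ∧ c' s(v, w) = α)).card ≤ s - 1 := by
  induction W using Finset.induction_on with
  | empty =>
    intro _ _
    exact ⟨c, fun _ _ => rfl, by simpa using hmaj, by simp, by simp⟩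
  | insert w W hw ih =>
    intro hW hcard
    rw [Finset.card_insert_of_notMem hw] at hcard
    obtain ⟨c₁, h1, h2, h3, h4⟩ := ih (fun x hx => hW x (Finset.mem_insert_of_mem hx)) (by omega)
    obtain ⟨hvw, hwD⟩ := hW w (Finset.mem_insert_self _ _)
    set D₁ := D ∪ W.image (fun w => s(v, w)) with hD₁
    have hnew : s(v, w) ∉ D₁ := by
      simp only [hD₁, Finset.mem_union, Finset.mem_image, not_or, not_exists, not_and]
      refine ⟨hwD, fun x hx h => ?_⟩
      rw [Sym2.congr_right] at h
      exact hw (h ▸ hx)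
    let Z : Fin (s + 5) → Finset V :=
      fun α => W.filter (fun w => (∀ z, s(w, z) ∉ D) ∧ c₁ s(v, w) = α)
    let full : Finset (Fin (s + 5)) :=
      if ∀ z, s(w, z) ∉ D then Finset.univ.filter (fun α => s - 1 ≤ (Z α).card) else ∅
    have hsv : (dsat G D₁ c₁ v).card ≤ 2 := dsat_card_le G D₁ c₁ v w (hdeg v) hvw hnew
    have hsw : (dsat G D₁ c₁ w).card + full.card ≤ s + 0 := by
      by_cases hfr : ∀ z, s(w, z) ∉ D
      · have h5 : dsat G D₁ c₁ w = ∅ := by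
          apply dsat_empty G D₁ c₁ w (hdeg w)
          intro z hz
          simp only [hD₁, Finset.mem_union, Finset.mem_image] at hz
          rcases hz with hz | ⟨x, hx, hz⟩
          · exact hfr z hz
          · rw [Sym2.eq_iff] at hz
            rcases hz with hz | hz
            · exact hvw.ne hz.1
            · exact hw (hz.2 ▸ hx)
        have h6 : full.card * (s - 1) ≤ W.card := by
          calc full.card * (s - 1) ≤ ∑ α ∈ full, (Z α).card := by
                rw [← smul_eq_mul]
                apply Finset.card_nsmul_le_sum
                intro α hα
                simp only [full, if_pos hfr, Finset.mem_filter] at hα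
                exact hα.2
            _ ≤ ∑ α, (Z α).card := Finset.sum_le_univ_sum_of_nonneg (fun _ => Nat.zero_le _)
            _ ≤ ∑ α, (W.filter (fun w => c₁ s(v, w) = α)).card := by
                apply Finset.sum_le_sum
                intro α _
                apply Finset.card_le_card
                intro x hx
                simp only [Z, Finset.mem_filter] at hx ⊢
                exact ⟨hx.1, hx.2.2⟩
            _ = W.card := by
                rw [← Finset.card_eq_sum_card_fiberwise (f := fun w => c₁ s(v, w))
                  (t := Finset.univ) (fun _ _ => by simp)]
        rw [h5]
        simp only [Finset.card_empty, zero_add, add_zero]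
        by_contra hcon
        have h7 : (s + 1) * (s - 1) ≤ full.card * (s - 1) := Nat.mul_le_mul_right _ (by omega)
        obtain ⟨q, rfl⟩ : ∃ q, s = q + 1 := ⟨s - 1, by omega⟩
        simp only [Nat.add_sub_cancel] at h7 h6
        nlinarith
      · simp only [full, if_neg hfr, Finset.card_empty, add_zero]
        have := dsat_card_le G D₁ c₁ w v (hdeg w) hvw.symm (by rwa [Sym2.eq_swap])
        omega
    obtain ⟨α, hα⟩ := exists_color (dsat G D₁ c₁ v ∪ R ∪ (dsat G D₁ c₁ w ∪ full)) (by
      have a1 := Finset.card_union_le (dsat G D₁ c₁ v ∪ R) (dsat G D₁ c₁ w ∪ full)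
      have a2 := Finset.card_union_le (dsat G D₁ c₁ v) R
      have a3 := Finset.card_union_le (dsat G D₁ c₁ w) full
      omega)
    simp only [Finset.mem_union, not_or] at hα
    obtain ⟨⟨b1, b2⟩, b3, b4⟩ := hα
    have hne : ∀ x ∈ W, s(v, x) ≠ s(v, w) := fun x hx h => hw (Sym2.congr_right.1 h ▸ hx)
    refine ⟨Function.update c₁ s(v, w) α, ?_, ?_, ?_, ?_⟩
    · intro e he
      rw [Finset.image_insert, Finset.mem_insert, not_or] at he
      rw [Function.update_of_ne he.1]
      exact h1 e he.2
    · rw [Finset.image_insert, Finset.union_insert]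
      exact dmaj_insert G D₁ c₁ v w hvw hnew α h2 b1 b3
    · intro x hx
      rcases Finset.mem_insert.1 hx with rfl | hx
      · simpa using b2
      · rw [Function.update_of_ne (hne x hx)]
        exact h3 x hx
    · intro β
      have hsame : W.filter (fun w' => (∀ z, s(w', z) ∉ D) ∧
          Function.update c₁ s(v, w) α s(v, w') = β) = Z β := by
        apply Finset.filter_congr
        intro x hx
        rw [Function.update_of_ne (hne x hx)]
      rw [Finset.filter_insert, hsame]
      split_ifs with hc
      · rw [Function.update_self] at hc
        obtain ⟨hfr, rfl⟩ := hc
        have : (Z α).card < s - 1 := by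
          by_contra hcon
          apply b4
          simp only [full, if_pos hfr, Finset.mem_filter, Finset.mem_univ, true_and]
          omega
        have := Finset.card_insert_le w (Z α)
        omega
      · exact h4 β

lemma color_star {s : ℕ} (hs : 2 ≤ s) (hdeg : ∀ u, 2 ≤ G.degree u) (D : Finset (Sym2 V))
    (c : Sym2 V → Fin (s + 5)) (v : V) (hmaj : DMaj G D c) (R : Finset (Fin (s + 5)))
    (hR : R.card ≤ 2) (P : Finset (Fin (s + 5) → ℕ)) (hRP : R.card + P.card ≤ s) (W : Finset V)
    (hW : ∀ w ∈ W, G.Adj v w ∧ s(v, w) ∉ D) (hcard : W.card < s ^ 2) :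
    ∃ c' : Sym2 V → Fin (s + 5),
      (∀ e, e ∉ W.image (fun w => s(v, w)) → c' e = c e) ∧
      DMaj G (D ∪ W.image (fun w => s(v, w))) c' ∧
      (∀ w ∈ W, c' s(v, w) ∉ R) ∧
      (∀ α, (W.filter (fun w => (∀ z, s(w, z) ∉ D) ∧ c' s(v, w) = α)).card ≤ s) ∧
      (W.Nonempty → dcnt G (D ∪ W.image (fun w => s(v, w))) c' v ∉ P) := by
  rcases W.eq_empty_or_nonempty with rfl | ⟨w, hwW⟩
  · exact ⟨c, fun _ _ => rfl, by simpa using hmaj, by simp, by simp, by simp⟩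
  obtain ⟨W, hw, rfl⟩ : ∃ W', w ∉ W' ∧ insert w W' = W :=
    ⟨W.erase w, by simp, Finset.insert_erase hwW⟩
  rw [Finset.card_insert_of_notMem hw] at hcard
  obtain ⟨c₁, h1, h2, h3, h4⟩ := color_star1 G hs hdeg D c v hmaj R hR W
    (fun x hx => hW x (Finset.mem_insert_of_mem hx)) (by omega)
  obtain ⟨hvw, hwD⟩ := hW w (Finset.mem_insert_self _ _)
  set D₁ := D ∪ W.image (fun w => s(v, w)) with hD₁
  have hnew : s(v, w) ∉ D₁ := by
    simp only [hD₁, Finset.mem_union, Finset.mem_image, not_or, not_exists, not_and]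
    refine ⟨hwD, fun x hx h => ?_⟩
    rw [Sym2.congr_right] at h
    exact hw (h ▸ hx)
  let pal : Fin (s + 5) → Fin (s + 5) → ℕ :=
    fun α β => dcnt G D₁ c₁ v β + if β = α then 1 else 0
  let bad : Finset (Fin (s + 5)) := Finset.univ.filter (fun α => pal α ∈ P)
  have hbad : bad.card ≤ P.card := by
    apply Finset.card_le_card_of_injOn pal
    · intro α hα
      simpa [bad] using hα
    · intro α _ β _ hab
      have := congrFun hab α
      simp only [pal, if_true] at this
      by_contra hne
      rw [if_neg hne] at this
      omega
  have hsv : (dsat G D₁ c₁ v).card ≤ 2 := dsat_card_le G D₁ c₁ v w (hdeg v) hvw hnew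
  have hsw : (dsat G D₁ c₁ w).card ≤ 2 :=
    dsat_card_le G D₁ c₁ w v (hdeg w) hvw.symm (by rwa [Sym2.eq_swap])
  obtain ⟨α, hα⟩ := exists_color (dsat G D₁ c₁ v ∪ R ∪ (dsat G D₁ c₁ w ∪ bad)) (by
    have a1 := Finset.card_union_le (dsat G D₁ c₁ v ∪ R) (dsat G D₁ c₁ w ∪ bad)
    have a2 := Finset.card_union_le (dsat G D₁ c₁ v) R
    have a3 := Finset.card_union_le (dsat G D₁ c₁ w) bad
    omega)
  simp only [Finset.mem_union, not_or] at hα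
  obtain ⟨⟨b1, b2⟩, b3, b4⟩ := hα
  have hne : ∀ x ∈ W, s(v, x) ≠ s(v, w) := fun x hx h => hw (Sym2.congr_right.1 h ▸ hx)
  refine ⟨Function.update c₁ s(v, w) α, ?_, ?_, ?_, ?_, ?_⟩
  · intro e he
    rw [Finset.image_insert, Finset.mem_insert, not_or] at he
    rw [Function.update_of_ne he.1]
    exact h1 e he.2
  · rw [Finset.image_insert, Finset.union_insert]
    exact dmaj_insert G D₁ c₁ v w hvw hnew α h2 b1 b3
  · intro x hx
    rcases Finset.mem_insert.1 hx with rfl | hx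
    · simpa using b2
    · rw [Function.update_of_ne (hne x hx)]
      exact h3 x hx
  · intro β
    have hsame : W.filter (fun w' => (∀ z, s(w', z) ∉ D) ∧
        Function.update c₁ s(v, w) α s(v, w') = β) =
        W.filter (fun w' => (∀ z, s(w', z) ∉ D) ∧ c₁ s(v, w') = β) := by
      apply Finset.filter_congr
      intro x hx
      rw [Function.update_of_ne (hne x hx)]
    rw [Finset.filter_insert, hsame]
    have h5 := h4 β
    split_ifs with hc
    · have := Finset.card_insert_le w
        (W.filter (fun w' => (∀ z, s(w', z) ∉ D) ∧ c₁ s(v, w') = β))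
      omega
    · omega
  · intro _ hmem
    apply b4
    simp only [bad, Finset.mem_filter, Finset.mem_univ, true_and]
    rw [Finset.image_insert, Finset.union_insert] at hmem
    convert hmem using 1
    funext β
    exact (dcnt_insert G D₁ c₁ v w hvw hnew α β).symm

end Greedy

/-! ### Part 3: colouring along the ordering -/

section Main
variable {V : Type*} [Fintype V] [DecidableEq V] (G : SimpleGraph V) [DecidableRel G.Adj]

/-- `x` is the earliest neighbour of `w`, and it precedes `w`. -/
def FirstNbr (r : V → ℕ) (x w : V) : Prop :=
  G.Adj x w ∧ r x < r w ∧ ∀ z, G.Adj z w → r x ≤ r z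

/-- Edges that meet one of the first `t` vertices. -/
def DoneEdges (r : V → ℕ) (t : ℕ) : Finset (Sym2 V) :=
  ((Finset.univ ×ˢ Finset.univ).filter (fun p : V × V => G.Adj p.1 p.2 ∧ r p.1 < t)).image
    (fun p => s(p.1, p.2))

lemma mem_doneEdges (r : V → ℕ) (t : ℕ) (a b : V) :
    s(a, b) ∈ DoneEdges G r t ↔ G.Adj a b ∧ (r a < t ∨ r b < t) := by
  simp only [DoneEdges, Finset.mem_image, Finset.mem_filter, Finset.mem_product, Finset.mem_univ,
    true_and, Prod.exists, Sym2.eq_iff]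
  constructor
  · rintro ⟨x, y, ⟨h, hr⟩, (⟨rfl, rfl⟩ | ⟨rfl, rfl⟩)⟩
    · exact ⟨h, Or.inl hr⟩
    · exact ⟨h.symm, Or.inr hr⟩
  · rintro ⟨h, (hr | hr)⟩
    · exact ⟨a, b, ⟨h, hr⟩, Or.inl ⟨rfl, rfl⟩⟩
    · exact ⟨b, a, ⟨h.symm, hr⟩, Or.inr ⟨rfl, rfl⟩⟩

/-- The palette of a vertex: how often every colour occurs at it. -/
def pal {k : ℕ} (c : Sym2 V → Fin k) (u : V) : Fin k → ℕ := dcnt G Finset.univ c u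

/-- The invariant after processing the first `t` vertices. -/
structure ColInv (r : V → ℕ) (v1 v2 T : V) (s t : ℕ) (c : Sym2 V → Fin (s + 5)) : Prop where
  maj : DMaj G (DoneEdges G r t) c
  zero : c s(v1, v2) = 0
  zero' : ∀ a b, s(a, b) ∈ DoneEdges G r t → c s(a, b) = 0 → s(a, b) = s(v1, v2)
  one : ∀ w, G.Adj v1 w → c s(v1, w) = 1 → w = T
  one' : c s(v1, T) = 1
  cap : ∀ x α, r x < t → ∀ O : Finset V, (∀ w ∈ O, FirstNbr G r x w ∧ c s(x, w) = α) → O.card ≤ s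
  pals : ∀ x u v, r u < t → r v < t → FirstNbr G r x u → FirstNbr G r x v →
    c s(x, u) = c s(x, v) → pal G c u = pal G c v → u = v
  pal12 : 2 ≤ t → pal G c v1 ≠ pal G c v2

lemma base_inv {r : V → ℕ} (hinj : Function.Injective r) {v1 v2 T : V} {s : ℕ} (hs : 2 ≤ s)
    (hdeg : ∀ u, 2 ≤ G.degree u) (hdeg' : ∀ u, G.degree u ≤ s ^ 2)
    (h1 : r v1 = 0) (h12 : G.Adj v1 v2) (h1T : G.Adj v1 T) (h2T : v2 ≠ T) :
    ∃ c, ColInv G r v1 v2 T s 1 c := by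
  have h01 : (0 : Fin (s + 5)) ≠ 1 := by
    intro h
    have := congrArg Fin.val h
    simp at this
  let c0 : Sym2 V → Fin (s + 5) := fun e => if e = s(v1, v2) then 0 else 1
  let D0 : Finset (Sym2 V) := {s(v1, v2), s(v1, T)}
  have hne : s(v1, T) ≠ s(v1, v2) := fun h => h2T (Sym2.congr_right.1 h).symm
  have hD0 : ∀ e, e ∈ D0 ↔ e = s(v1, v2) ∨ e = s(v1, T) := by intro e; simp [D0]
  have hc01 : c0 s(v1, v2) = 0 := if_pos rfl
  have hc02 : c0 s(v1, T) = 1 := if_neg hne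
  have hmaj0 : DMaj G D0 c0 := by
    intro u α
    have : dcnt G D0 c0 u α ≤ 1 := by
      unfold dcnt
      rw [Finset.card_le_one]
      intro a ha b hb
      simp only [Finset.mem_filter, hD0] at ha hb
      obtain ⟨-, ha, ha'⟩ := ha
      obtain ⟨-, hb, hb'⟩ := hb
      have : s(u, a) = s(u, b) := by
        rcases ha with ha | ha <;> rcases hb with hb | hb
        · rw [ha, hb]
        · exfalso; rw [ha, hc01] at ha'; rw [hb, hc02] at hb'; exact h01 (ha'.trans hb'.symm)
        · exfalso; rw [ha, hc02] at ha'; rw [hb, hc01] at hb'; exact h01 (hb'.trans ha'.symm)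
        · rw [ha, hb]
      exact Sym2.congr_right.1 this
    have := hdeg u
    omega
  let W := ((G.neighborFinset v1).erase v2).erase T
  have hWmem : ∀ w, w ∈ W ↔ w ≠ T ∧ w ≠ v2 ∧ G.Adj v1 w := by intro w; simp [W]
  have hWc : W.card < s ^ 2 := by
    have : W.card < (G.neighborFinset v1).card := by
      apply Finset.card_lt_card
      refine ⟨fun w hw => by simpa using ((hWmem w).1 hw).2.2, fun h => ?_⟩
      have := h ((mem_neighborFinset G v1 T).2 h1T)
      exact ((hWmem T).1 this).1 rfl
    rw [card_neighborFinset_eq_degree] at this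
    exact this.trans_le (hdeg' v1)
  obtain ⟨c, hc, hmaj, hR, hcap, -⟩ := color_star G hs hdeg D0 c0 v1 hmaj0 {0, 1}
    (Finset.card_le_two) ∅ (by
      have : ({0, 1} : Finset (Fin (s + 5))).card ≤ 2 := Finset.card_le_two
      simp only [Finset.card_empty]; omega) W
    (fun w hw => by
      obtain ⟨ha, hb, hab⟩ := (hWmem w).1 hw
      refine ⟨hab, fun h => ?_⟩
      rcases (hD0 _).1 h with h | h
      · exact hb (Sym2.congr_right.1 h)
      · exact ha (Sym2.congr_right.1 h)) hWc
  have hnW : ∀ w, w ∉ W → c s(v1, w) = c0 s(v1, w) := by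
    intro w hw
    apply hc
    simp only [Finset.mem_image, not_exists, not_and]
    intro x hx h
    rw [Sym2.congr_right] at h
    exact hw (h ▸ hx)
  have hcv2 : c s(v1, v2) = 0 := by
    rw [hnW _ (fun h => ((hWmem _).1 h).2.1 rfl)]; exact hc01
  have hcT : c s(v1, T) = 1 := by
    rw [hnW _ (fun h => ((hWmem _).1 h).1 rfl)]; exact hc02
  have hR0 : ∀ w, w ∈ W → c s(v1, w) ≠ 0 ∧ c s(v1, w) ≠ 1 := by
    intro w hw
    have := hR w hw
    simpa using this
  have htri : ∀ w, G.Adj v1 w → w = v2 ∨ w = T ∨ w ∈ W := by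
    intro w hw
    rw [hWmem]; tauto
  have hone : ∀ w, G.Adj v1 w → c s(v1, w) = 1 → w = T := by
    intro w hw h
    rcases htri w hw with rfl | h' | h'
    · rw [hcv2] at h; exact absurd h h01
    · exact h'
    · exact absurd h (hR0 w h').2
  have hzero : ∀ w, G.Adj v1 w → c s(v1, w) = 0 → w = v2 := by
    intro w hw h
    rcases htri w hw with h' | rfl | h'
    · exact h'
    · rw [hcT] at h; exact absurd h.symm h01
    · exact absurd h (hR0 w h').1
  have hr0 : ∀ x, r x < 1 → x = v1 := fun x hx => hinj (by omega)
  have hU : ∀ a b, s(a, b) ∈ DoneEdges G r 1 ↔ s(a, b) ∈ D0 ∪ W.image (fun w => s(v1, w)) := by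
    intro a b
    rw [mem_doneEdges, Finset.mem_union, hD0, Finset.mem_image]
    constructor
    · have key : ∀ y, G.Adj v1 y → (s(v1, y) = s(v1, v2) ∨ s(v1, y) = s(v1, T)) ∨
          ∃ w ∈ W, s(v1, w) = s(v1, y) := by
        intro y hy
        rcases htri y hy with rfl | rfl | h
        · exact Or.inl (Or.inl rfl)
        · exact Or.inl (Or.inr rfl)
        · exact Or.inr ⟨y, h, rfl⟩
      rintro ⟨hab, (h | h)⟩
      · obtain rfl := hr0 a h
        exact key b hab
      · obtain rfl := hr0 b h
        rw [Sym2.eq_swap]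
        exact key a hab.symm
    · have key : ∀ y, G.Adj v1 y → s(a, b) = s(v1, y) → G.Adj a b ∧ (r a < 1 ∨ r b < 1) := by
        intro y hy h
        rw [Sym2.eq_iff] at h
        rcases h with ⟨rfl, rfl⟩ | ⟨rfl, rfl⟩
        · exact ⟨hy, Or.inl (by omega)⟩
        · exact ⟨hy.symm, Or.inr (by omega)⟩
      rintro ((h | h) | ⟨w, hw, h⟩)
      · exact key _ h12 h
      · exact key _ h1T h
      · exact key _ ((hWmem w).1 hw).2.2 h.symm
  refine ⟨c, ?_, hcv2, ?_, hone, hcT, ?_, ?_, by omega⟩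
  · intro u α
    rw [dcnt_congr G (D' := D0 ∪ W.image (fun w => s(v1, w))) (c' := c) u (fun w _ => hU u w)
      (fun _ _ _ => rfl)]
    exact hmaj u α
  · intro a b hab h0
    rw [mem_doneEdges] at hab
    obtain ⟨hab, h | h⟩ := hab
    · obtain rfl := hr0 a h
      rw [hzero b hab h0]
    · obtain rfl := hr0 b h
      rw [Sym2.eq_swap] at h0 ⊢
      rw [hzero a hab.symm h0]
  · intro x α hx O hO
    obtain rfl := hr0 x hx
    by_cases hα0 : α = 0
    · have : O ⊆ {v2} := by
        intro w hw
        rw [Finset.mem_singleton]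
        exact hzero w (hO w hw).1.1 (by rw [(hO w hw).2, hα0])
      have := Finset.card_le_card this
      simp at this; omega
    by_cases hα1 : α = 1
    · have : O ⊆ {T} := by
        intro w hw
        rw [Finset.mem_singleton]
        exact hone w (hO w hw).1.1 (by rw [(hO w hw).2, hα1])
      have := Finset.card_le_card this
      simp at this; omega
    refine le_trans (Finset.card_le_card ?_) (hcap α)
    intro w hw
    obtain ⟨hf, hcw⟩ := hO w hw
    have hw2 : w ≠ v2 := by rintro rfl; exact hα0 (by rw [← hcw, hcv2])
    have hwT : w ≠ T := by rintro rfl; exact hα1 (by rw [← hcw, hcT])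
    rw [Finset.mem_filter]
    refine ⟨(hWmem w).2 ⟨hwT, hw2, hf.1⟩, fun z hz => ?_, hcw⟩
    rw [hD0, Sym2.eq_iff, Sym2.eq_iff] at hz
    have := hf.1.ne
    tauto
  · intro x u v hu hv
    intros
    rw [hr0 u hu, hr0 v hv]

lemma step_inv {r : V → ℕ} (hinj : Function.Injective r) {v1 v2 T : V} {s t : ℕ} (hs : 2 ≤ s)
    (hdeg : ∀ u, 2 ≤ G.degree u) (hdeg' : ∀ u, G.degree u ≤ s ^ 2)
    (h1 : r v1 = 0) (h2 : r v2 = 1) (h12 : G.Adj v1 v2) (h1T : G.Adj v1 T) (ht : 1 ≤ t)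
    (c : Sym2 V → Fin (s + 5)) (hI : ColInv G r v1 v2 T s t c) (v : V) (hv : r v = t)
    (hearly : ∃ u, G.Adj u v ∧ r u < r v) (hlate : ∃ u, G.Adj v u ∧ r v < r u) :
    ∃ c', ColInv G r v1 v2 T s (t + 1) c' := by
  classical
  let W := (G.neighborFinset v).filter (fun w => t < r w)
  have hWmem : ∀ w, w ∈ W ↔ G.Adj v w ∧ t < r w := by intro w; simp [W]
  have hWne : W.Nonempty := by
    obtain ⟨u, hu, hr⟩ := hlate
    exact ⟨u, (hWmem u).2 ⟨hu, by omega⟩⟩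
  have hWc : W.card < s ^ 2 := by
    have : W.card < (G.neighborFinset v).card := by
      apply Finset.card_lt_card
      refine ⟨Finset.filter_subset _ _, fun h => ?_⟩
      obtain ⟨u, hu, hr⟩ := hearly
      have := (hWmem u).1 (h ((mem_neighborFinset G v u).2 hu.symm))
      omega
    rw [card_neighborFinset_eq_degree] at this
    exact this.trans_le (hdeg' v)
  have hFuniq : ∀ x y w, FirstNbr G r x w → FirstNbr G r y w → x = y := by
    intro x y w hx hy
    exact hinj (le_antisymm (hx.2.2 y hy.1) (hy.2.2 x hx.1))
  let S := Finset.univ.filter (fun u => r u < t ∧ ∃ x, FirstNbr G r x u ∧ FirstNbr G r x v ∧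
    c s(x, u) = c s(x, v))
  let S' : Finset V := if t = 1 then {v1} else S
  have hS' : S'.card + 1 ≤ s := by
    by_cases h : t = 1
    · simp only [S', if_pos h, Finset.card_singleton]; omega
    · simp only [S', if_neg h]
      by_cases hx : ∃ x, FirstNbr G r x v
      · obtain ⟨x, hx⟩ := hx
        have hvS : v ∉ S := by simp [S, hv]
        rw [← Finset.card_insert_of_notMem hvS]
        apply hI.cap x (c s(x, v)) (by have := hx.2.1; omega)
        intro w hw
        rcases Finset.mem_insert.1 hw with rfl | hw
        · exact ⟨hx, rfl⟩
        · simp only [S, Finset.mem_filter, Finset.mem_univ, true_and] at hw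
          obtain ⟨-, y, hy1, hy2, hy3⟩ := hw
          obtain rfl := hFuniq _ _ _ hy2 hx
          exact ⟨hy1, hy3⟩
      · have : S = ∅ := by
          rw [Finset.eq_empty_iff_forall_notMem]
          intro u hu
          simp only [S, Finset.mem_filter, Finset.mem_univ, true_and] at hu
          obtain ⟨-, y, hy1, hy2, hy3⟩ := hu
          exact hx ⟨y, hy2⟩
        rw [this]; simp; omega
  obtain ⟨c', hc, hmaj, hR, hcap, hP⟩ := color_star G hs hdeg (DoneEdges G r t) c v hI.maj {0}
    (by simp) (S'.image (pal G c)) (by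
      have : (S'.image (pal G c)).card ≤ S'.card := Finset.card_image_le
      simp only [Finset.card_singleton]; omega) W
    (fun w hw => by
      obtain ⟨ha, hb⟩ := (hWmem w).1 hw
      refine ⟨ha, fun h => ?_⟩
      rw [mem_doneEdges] at h
      omega) hWc
  have hP := hP hWne
  have hold : ∀ a b, r a < t → c' s(a, b) = c s(a, b) := by
    intro a b ha
    apply hc
    simp only [Finset.mem_image, not_exists, not_and]
    intro x hx h
    have hx := (hWmem x).1 hx
    rw [Sym2.eq_iff] at h
    rcases h with ⟨rfl, rfl⟩ | ⟨rfl, rfl⟩ <;> omega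
  have holdpal : ∀ u, r u < t → pal G c' u = pal G c u := by
    intro u hu
    funext α
    exact dcnt_congr G u (fun _ _ => Iff.rfl) (fun w _ _ => hold u w hu) α
  have hU : ∀ a b, s(a, b) ∈ DoneEdges G r (t + 1) ↔
      s(a, b) ∈ DoneEdges G r t ∪ W.image (fun w => s(v, w)) := by
    intro a b
    rw [mem_doneEdges, Finset.mem_union, mem_doneEdges, Finset.mem_image]
    constructor
    · rintro ⟨hab, h⟩
      by_cases h' : r a < t ∨ r b < t
      · exact Or.inl ⟨hab, h'⟩
      · right
        rcases h with h | h
        · obtain rfl : a = v := hinj (by omega)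
          refine ⟨b, (hWmem b).2 ⟨hab, ?_⟩, rfl⟩
          have : r a ≠ r b := fun h => hab.ne (hinj h)
          omega
        · obtain rfl : b = v := hinj (by omega)
          refine ⟨a, (hWmem a).2 ⟨hab.symm, ?_⟩, Sym2.eq_swap⟩
          have : r a ≠ r b := fun h => hab.ne (hinj h)
          omega
    · rintro (⟨hab, h⟩ | ⟨w, hw, h⟩)
      · exact ⟨hab, by omega⟩
      · have hw := (hWmem w).1 hw
        rw [Sym2.eq_iff] at h
        rcases h with ⟨rfl, rfl⟩ | ⟨rfl, rfl⟩
        · exact ⟨hw.1, by omega⟩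
        · exact ⟨hw.1.symm, by omega⟩
  have hpv : pal G c' v = dcnt G (DoneEdges G r t ∪ W.image (fun w => s(v, w))) c' v := by
    funext α
    refine dcnt_congr G v (fun w hw => ?_) (fun _ _ _ => rfl) α
    rw [← hU, mem_doneEdges]
    simp only [Finset.mem_univ, true_iff]
    exact ⟨hw, by omega⟩
  rw [← hpv] at hP
  have hP' : ∀ u ∈ S', pal G c' v ≠ pal G c u := by
    intro u hu h
    exact hP (Finset.mem_image.2 ⟨u, hu, h.symm⟩)
  have hpals : ∀ x u, r u < t → FirstNbr G r x u → FirstNbr G r x v →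
      c s(x, u) = c s(x, v) → pal G c' u ≠ pal G c' v := by
    intro x u hu hxu hxv hcc h
    rw [holdpal u hu] at h
    refine hP' u ?_ h.symm
    have hx := hxu.2.1
    have : t ≠ 1 := by omega
    simp only [S', if_neg this, S, Finset.mem_filter, Finset.mem_univ, true_and]
    exact ⟨hu, x, hxu, hxv, hcc⟩
  refine ⟨c', ?_, ?_, ?_, ?_, ?_, ?_, ?_, ?_⟩
  · intro u α
    rw [dcnt_congr G (D' := DoneEdges G r t ∪ W.image (fun w => s(v, w))) (c' := c') u
      (fun w _ => hU u w) (fun _ _ _ => rfl)]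
    exact hmaj u α
  · rw [hold v1 v2 (by omega)]; exact hI.zero
  · intro a b hab h0
    rw [hU, Finset.mem_union] at hab
    rcases hab with hab | hab
    · apply hI.zero' a b hab
      rw [← h0]
      rcases ((mem_doneEdges G r t a b).1 hab).2 with h | h
      · exact (hold a b h).symm
      · rw [Sym2.eq_swap]; exact (hold b a h).symm
    · obtain ⟨w, hw, h⟩ := Finset.mem_image.1 hab
      have := hR w hw
      rw [h, Finset.mem_singleton] at this
      exact absurd h0 this
  · intro w hw h
    rw [hold v1 w (by omega)] at h
    exact hI.one w hw h
  · rw [hold v1 T (by omega)]; exact hI.one'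
  · intro x α hx O hO
    by_cases hxt : r x < t
    · apply hI.cap x α hxt O
      intro w hw
      rw [← hold x w hxt]
      exact hO w hw
    · obtain rfl : x = v := hinj (by omega)
      refine le_trans (Finset.card_le_card ?_) (hcap α)
      intro w hw
      obtain ⟨hf, hcw⟩ := hO w hw
      rw [Finset.mem_filter]
      refine ⟨(hWmem w).2 ⟨hf.1, by have := hf.2.1; omega⟩, fun z hz => ?_, hcw⟩
      rw [mem_doneEdges] at hz
      have h3 := hf.2.2 z hz.1.symm
      have h4 := hf.2.1
      omega
  · intro x a b ha hb hxa hxb hcc hpp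
    have hxat := hxa.2.1
    have hxbt := hxb.2.1
    rw [hold x a (by omega), hold x b (by omega)] at hcc
    by_cases ha' : r a < t
    · by_cases hb' : r b < t
      · rw [holdpal a ha', holdpal b hb'] at hpp
        exact hI.pals x a b ha' hb' hxa hxb hcc hpp
      · obtain rfl : b = v := hinj (by omega)
        exact absurd hpp (hpals x a ha' hxa hxb hcc)
    · obtain rfl : a = v := hinj (by omega)
      by_cases hb' : r b < t
      · exact absurd hpp.symm (hpals x b hb' hxb hxa hcc.symm)
      · exact hinj (by omega)
  · intro _
    by_cases h : t = 1
    · obtain rfl : v = v2 := hinj (by omega)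
      rw [holdpal v1 (by omega)]
      exact (hP' v1 (by simp [S', h])).symm
    · rw [holdpal v1 (by omega), holdpal v2 (by omega)]
      exact hI.pal12 (by omega)

lemma final_inv {r : V → ℕ} (hinj : Function.Injective r) {v1 v2 T : V} {s : ℕ}
    (hcard : 3 ≤ Fintype.card V)
    (hlt : ∀ v, r v < Fintype.card V) (h1 : r v1 = 0) (h2 : r v2 = 1)
    (hT : r T + 1 = Fintype.card V) (h12 : G.Adj v1 v2) (h1T : G.Adj v1 T)
    (hearly : ∀ v, v ≠ v1 → ∃ u, G.Adj u v ∧ r u < r v)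
    (c : Sym2 V → Fin (s + 5)) (hI : ColInv G r v1 v2 T s (Fintype.card V - 1) c) :
    IsMajorityEdgeColoring G c ∧ IsDistinguishingEdgeColoring G c := by
  have hall : ∀ a b, G.Adj a b → s(a, b) ∈ DoneEdges G r (Fintype.card V - 1) := by
    intro a b hab
    rw [mem_doneEdges]
    refine ⟨hab, ?_⟩
    have : r a ≠ r b := fun h => hab.ne (hinj h)
    have := hlt a
    have := hlt b
    omega
  constructor
  · intro u α
    have := hI.maj u α
    unfold dcnt at this
    convert this using 3
    apply Finset.filter_congr
    intro w hw
    rw [mem_neighborFinset] at hw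
    simp [hall u w hw]
  · intro φ hφ
    have hpal : ∀ u, pal G c (φ u) = pal G c u := by
      intro u
      funext α
      unfold pal dcnt
      symm
      apply Finset.card_bij (fun w _ => φ w)
      · intro w hw
        simp only [Finset.mem_filter, mem_neighborFinset, Finset.mem_univ, true_and] at hw ⊢
        exact ⟨φ.map_adj_iff.2 hw.1, by rw [hφ u w hw.1]; exact hw.2⟩
      · intro a _ b _ h
        exact φ.injective h
      · intro b hb
        obtain ⟨w, rfl⟩ := φ.surjective b
        simp only [Finset.mem_filter, mem_neighborFinset, Finset.mem_univ, true_and] at hb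
        have hw : G.Adj u w := φ.map_adj_iff.1 hb.1
        refine ⟨w, ?_, rfl⟩
        simp only [Finset.mem_filter, mem_neighborFinset, Finset.mem_univ, true_and]
        exact ⟨hw, by rw [← hφ u w hw]; exact hb.2⟩
    have hfix1 : φ v1 = v1 := by
      have h := hI.zero' (φ v1) (φ v2) (hall _ _ (φ.map_adj_iff.2 h12))
        (by rw [hφ v1 v2 h12]; exact hI.zero)
      rw [Sym2.eq_iff] at h
      rcases h with h | h
      · exact h.1
      · exfalso
        apply hI.pal12 (by omega)
        rw [← hpal v1, h.1]
    have main : ∀ t, ∀ v, r v = t → φ v = v := by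
      intro t
      induction t using Nat.strong_induction_on with
      | _ t ih =>
        intro v hv
        by_cases hv1 : v = v1
        · rw [hv1]; exact hfix1
        have ih' : ∀ u, r u < r v → φ u = u := fun u hu => ih (r u) (by omega) u rfl
        obtain ⟨u, huv, hru⟩ := hearly v hv1
        obtain ⟨x, hx, hmin⟩ := Finset.exists_min_image (G.neighborFinset v) r
          ⟨u, (mem_neighborFinset G v u).2 huv.symm⟩
        rw [mem_neighborFinset] at hx
        have hxv : FirstNbr G r x v := by
          refine ⟨hx.symm, ?_, fun z hz => hmin z ((mem_neighborFinset G v z).2 hz.symm)⟩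
          have := hmin u ((mem_neighborFinset G v u).2 huv.symm)
          omega
        have hfx : φ x = x := ih' x hxv.2.1
        have hadj : G.Adj x (φ v) := by
          have := φ.map_adj_iff.2 hxv.1
          rwa [hfx] at this
        have hge : r v ≤ r (φ v) := by
          by_contra hcon
          have h3 := ih' (φ v) (by omega)
          have := φ.injective h3
          rw [this] at hcon
          omega
        have hcol : c s(x, φ v) = c s(x, v) := by
          have := hφ x v hxv.1
          rwa [hfx] at this
        have hxfv : FirstNbr G r x (φ v) := by
          refine ⟨hadj, lt_of_lt_of_le hxv.2.1 hge, fun z hz => ?_⟩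
          by_contra hcon
          have hzz := ih' z (by have := hxv.2.1; omega)
          rw [← hzz] at hz
          have := hxv.2.2 z (φ.map_adj_iff.1 hz)
          omega
        have hTcase : ∀ w, FirstNbr G r x w → w = T → x = v1 := by
          intro w hw hwT
          subst hwT
          have := hw.2.2 v1 h1T
          exact hinj (by omega)
        by_cases hvT : v = T
        · have hxv1 := hTcase v hxv hvT
          subst hxv1
          have : c s(x, φ v) = 1 := by rw [hcol, hvT]; exact hI.one'
          rw [hI.one _ hadj this, hvT]
        by_cases hfvT : φ v = T
        · have hxv1 := hTcase (φ v) hxfv hfvT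
          subst hxv1
          have : c s(x, v) = 1 := by rw [← hcol, hfvT]; exact hI.one'
          rw [hfvT, hI.one _ hxv.1 this]
        have hrT : ∀ w, w ≠ T → r w < Fintype.card V - 1 := by
          intro w hw
          have h3 : r w ≠ r T := fun h => hw (hinj h)
          have := hlt w
          omega
        exact hI.pals x (φ v) v (hrT _ hfvT) (hrT _ hvT) hxfv hxv hcol (hpal v)
    intro x
    exact main _ x rfl

end Main

/-- If `G` is a finite 2-connected graph (at least 3 vertices, and deleting any vertex leaves
a connected graph) with maximum degree `Δ`, then `M'_D(G) ≤ ⌈√Δ⌉ + 5`. -/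
theorem majority_distinguishing_index_le_of_two_connected {V : Type*} [Fintype V]
    [DecidableEq V] (G : SimpleGraph V) [DecidableRel G.Adj]
    (hcard : 3 ≤ Fintype.card V)
    (h2conn : ∀ v : V, (G.induce ({v}ᶜ : Set V)).Connected) :
    ∃ c : Sym2 V → Fin (⌈Real.sqrt (G.maxDegree : ℝ)⌉₊ + 5),
      IsMajorityEdgeColoring G c ∧ IsDistinguishingEdgeColoring G c := by
  have h2 : ∀ v, CutConn G ({v}ᶜ : Finset V) := fun v => cutConn_of_induce G v (h2conn v)
  have hnbr : ∀ v w : V, v ≠ w → ∃ z, G.Adj v z ∧ z ≠ w := by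
    intro v w hvw
    obtain ⟨y, hy⟩ : ∃ y, y ∉ ({v, w} : Finset V) := by
      by_contra hcon
      push Not at hcon
      have h3 : (Finset.univ : Finset V) ⊆ {v, w} := fun y _ => hcon y
      have h4 := Finset.card_le_card h3
      rw [Finset.card_univ] at h4
      have : ({v, w} : Finset V).card ≤ 2 := Finset.card_le_two
      omega
    simp only [Finset.mem_insert, Finset.mem_singleton, not_or] at hy
    obtain ⟨a, ha, b, hb, hab⟩ := h2 w {v} (by simpa using hvw.symm) (by simp) ⟨y, by simp [hy]⟩
    rw [Finset.mem_singleton] at ha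
    subst ha
    simp only [Finset.mem_sdiff, Finset.mem_compl, Finset.mem_singleton] at hb
    exact ⟨b, hab, hb.1⟩
  have hnt : Nontrivial V := Fintype.one_lt_card_iff_nontrivial.1 (by omega)
  have hdeg : ∀ u, 2 ≤ G.degree u := by
    intro u
    obtain ⟨w, hw⟩ := exists_ne u
    obtain ⟨z, hz, -⟩ := hnbr u w hw.symm
    obtain ⟨z', hz', hne⟩ := hnbr u z hz.ne
    have h3 : ({z, z'} : Finset V) ⊆ G.neighborFinset u := by
      intro x hx
      rw [Finset.mem_insert, Finset.mem_singleton] at hx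
      rw [mem_neighborFinset]
      rcases hx with rfl | rfl
      · exact hz
      · exact hz'
    have h4 := Finset.card_le_card h3
    rw [Finset.card_pair hne.symm, card_neighborFinset_eq_degree] at h4
    exact h4
  set s := ⌈Real.sqrt (G.maxDegree : ℝ)⌉₊ with hsdef
  have hmax : G.maxDegree ≤ s ^ 2 := by
    have h3 : Real.sqrt (G.maxDegree : ℝ) ≤ (s : ℝ) := Nat.le_ceil _
    have h4 : (G.maxDegree : ℝ) ≤ (s : ℝ) ^ 2 := by
      rw [Real.sqrt_le_left (Nat.cast_nonneg s)] at h3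
      exact h3
    exact_mod_cast h4
  have hdeg' : ∀ u, G.degree u ≤ s ^ 2 := fun u => (G.degree_le_maxDegree u).trans hmax
  obtain ⟨v1, w1, hvw1⟩ := hnt
  have hs : 2 ≤ s := by
    by_contra hcon
    have h3 : s ≤ 1 := by omega
    have h4 : s ^ 2 ≤ 1 := by nlinarith
    have := hdeg v1
    have := hdeg' v1
    omega
  obtain ⟨T, h1T, -⟩ := hnbr v1 w1 hvw1
  obtain ⟨r, hinj, hlt, hsurj, h1, hT, hearly, hlate⟩ := exists_order G hcard h2 v1 T h1T
  obtain ⟨v2, hr2⟩ := hsurj 1 (by omega)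
  have h12 : G.Adj v1 v2 := by
    obtain ⟨u, hu, hru⟩ := hearly v2 (by rintro rfl; omega)
    obtain rfl : u = v1 := hinj (by omega)
    exact hu
  have h2T : v2 ≠ T := by rintro rfl; omega
  have hind : ∀ t, 1 ≤ t → t ≤ Fintype.card V - 1 → ∃ c, ColInv G r v1 v2 T s t c := by
    intro t ht
    induction t, ht using Nat.le_induction with
    | base => intro _; exact base_inv G hinj hs hdeg hdeg' h1 h12 h1T h2T
    | succ t ht ih =>
      intro hle
      obtain ⟨c, hc⟩ := ih (by omega)
      obtain ⟨v, hv⟩ := hsurj t (by omega)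
      exact step_inv G hinj hs hdeg hdeg' h1 hr2 h12 h1T ht c hc v hv
        (hearly v (by rintro rfl; omega)) (hlate v (by rintro rfl; omega))
  obtain ⟨c, hc⟩ := hind (Fintype.card V - 1) (by omega) le_rfl
  exact ⟨c, final_inv G hinj hcard hlt h1 hr2 hT h12 h1T hearly c hc⟩
end
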